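/- arXiv:1507.01215 — 6 statements merged into one kernel-verified Lean document; each statement's English description precedes it below -/
import Mathlib

section
/- There exists a single learner M (a total computable map from finite sequences over ℕ to ℕ) which learns the class of all total recursive functions such that for every total recursive f : ℕ → ℕ, with e_n = M(f(0),...,f(n-1)): (i) M is a BC* learner: for almost all n, φ_{e_n} is a finite variant of f (i.e. {x : φ_{e_n}(x) ≠ f(x)} is finite, where φ_{e_n}(x) ≠ f(x) includes the case φ_{e_n}(x) undefined); (ii) M is a partial learner: there is exactly one index e such that e_n = e for infinitely many n, and this e satisfies φ_e = f; (iii) M is an approximate learner: there is a sequence (S_n) of subsets of ℕ with S_n ⊆ S_{n+1} for all n, ⋃_n S_n = ℕ, S_{n+1} − S_n infinite for infinitely many n, and φ_{e_n}(x) = f(x) for all x ∈ S_n and all n. -/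
open Filter

/-- The `e`-th partial recursive function in a fixed acceptable numbering. -/
def phi (e : ℕ) : ℕ →. ℕ := Nat.Partrec.Code.eval (Denumerable.ofNat Nat.Partrec.Code e)

/-- The finite sequence `f(0), ..., f(n-1)`. -/
def fpref (f : ℕ → ℕ) (n : ℕ) : List ℕ := (List.range n).map f

/-- `M` approximately (Approx) learns the total recursive function `f`:
there is an ascending sequence of sets `S n` covering `ℕ`, with `S (n+1) \ S n`
infinite for infinitely many `n`, such that the `n`-th hypothesis of `M` on `f`
is correct on all of `S n`. -/
def ApproxLearnsFn (M : List ℕ → ℕ) (f : ℕ → ℕ) : Prop :=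
  ∃ S : ℕ → Set ℕ, (∀ n, S n ⊆ S (n + 1)) ∧ (⋃ n, S n) = Set.univ ∧
    {n | (S (n + 1) \ S n).Infinite}.Infinite ∧
    ∀ n, ∀ x ∈ S n, f x ∈ phi (M (fpref f n)) x

open Nat.Partrec (Code)
open Encodable

namespace FunctionLearner

/-- The least `i < n` satisfying `p`, or `n` if there is none. -/
def boundedLeast (p : ℕ → Bool) (n : ℕ) : ℕ := (List.range n).findIdx p

lemma boundedLeast_le (p : ℕ → Bool) (n : ℕ) : boundedLeast p n ≤ n := by
  simpa [boundedLeast] using List.findIdx_le_length (p := p) (xs := List.range n)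

lemma eq_false_of_lt_boundedLeast {p : ℕ → Bool} {n i : ℕ} (h : i < boundedLeast p n) :
    p i = false := by
  simpa using List.not_of_lt_findIdx (p := p) (xs := List.range n) h

lemma boundedLeast_spec {p : ℕ → Bool} {n : ℕ} (h : boundedLeast p n < n) :
    p (boundedLeast p n) = true := by
  have := List.findIdx_getElem (p := p) (xs := List.range n) (w := by simpa [boundedLeast] using h)
  rwa [List.getElem_range] at this

lemma boundedLeast_le_of {p : ℕ → Bool} {n i : ℕ} (h : p i = true) : boundedLeast p n ≤ i := by
  by_contra hlt
  simp [eq_false_of_lt_boundedLeast (not_le.1 hlt)] at h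

lemma le_boundedLeast {p : ℕ → Bool} {n k : ℕ} (hk : k ≤ n) (h : ∀ i < k, p i = false) :
    k ≤ boundedLeast p n := by
  by_contra! hlt
  simpa [h _ hlt] using boundedLeast_spec (hlt.trans_le hk)

lemma boundedLeast_eq {p : ℕ → Bool} {n k : ℕ} (hk : k ≤ n) (hp : k < n → p k = true)
    (h : ∀ i < k, p i = false) : boundedLeast p n = k := by
  refine le_antisymm ?_ (le_boundedLeast hk h)
  rcases hk.eq_or_lt with rfl | hlt
  · exact boundedLeast_le _ _
  · exact boundedLeast_le_of (hp hlt)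

lemma boundedLeast_congr {p q : ℕ → Bool} {n : ℕ} (h : ∀ i < n, p i = q i) :
    boundedLeast p n = boundedLeast q n := by
  refine boundedLeast_eq (boundedLeast_le q n) (fun hlt => ?_) fun i hi => ?_
  · rw [h _ hlt, boundedLeast_spec hlt]
  · rw [h _ (hi.trans_le (boundedLeast_le q n)), eq_false_of_lt_boundedLeast hi]

lemma primrec_boundedLeast {α : Type*} [Primcodable α] {p : α → ℕ → Bool} {n : α → ℕ}
    (hp : Primrec₂ p) (hn : Primrec n) : Primrec fun a => boundedLeast (p a) (n a) :=
  Primrec.list_findIdx (Primrec.list_range.comp hn) hp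

/-- The length of the longest initial segment on which the `e`-th program agrees with `g`
within `s` steps of computation. -/
def agreement (g : ℕ → ℕ) (e s : ℕ) : ℕ :=
  boundedLeast (fun y => !decide (Code.evaln s (Denumerable.ofNat Code e) y = some (g y))) s

lemma agreement_le (g : ℕ → ℕ) (e s : ℕ) : agreement g e s ≤ s := boundedLeast_le _ _

lemma le_agreement_iff {g : ℕ → ℕ} {e s k : ℕ} :
    k ≤ agreement g e s ↔ ∀ y < k, Code.evaln s (Denumerable.ofNat Code e) y = some (g y) := by
  constructor
  · intro h y hy
    simpa using eq_false_of_lt_boundedLeast (hy.trans_le h)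
  · intro h
    refine le_boundedLeast ?_ fun y hy => by simp [h y hy]
    by_contra! hlt
    exact (Code.evaln_bound (h s hlt)).false

lemma agreement_mono (g : ℕ → ℕ) (e : ℕ) : Monotone (agreement g e) := fun _ _ hst =>
  le_agreement_iff.2 fun y hy => Code.evaln_mono hst (le_agreement_iff.1 le_rfl y hy)

lemma agreement_congr {g h : ℕ → ℕ} {s : ℕ} (hgh : ∀ y < s, g y = h y) (e : ℕ) :
    agreement g e s = agreement h e s :=
  boundedLeast_congr fun y hy => by rw [hgh y hy]

lemma agreement_lt_iff_congr {g h : ℕ → ℕ} {j : ℕ} (hgh : ∀ y ≤ j, g y = h y) (e x : ℕ) :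
    agreement g e j < agreement g e x ↔ agreement h e j < agreement h e x := by
  rw [agreement_congr (fun y hy => hgh y hy.le) e, ← Nat.succ_le_iff, ← Nat.succ_le_iff,
    le_agreement_iff, le_agreement_iff]
  refine forall₂_congr fun y hy => ?_
  rw [hgh y ((Nat.lt_succ_iff.1 hy).trans (agreement_le h e j))]

lemma agreement_le_of_not_mem {f : ℕ → ℕ} {e y : ℕ} (h : f y ∉ phi e y) (s : ℕ) :
    agreement f e s ≤ y := by
  by_contra! hlt
  exact h (Code.evaln_sound (le_agreement_iff.1 le_rfl y hlt))

lemma exists_le_agreement {f : ℕ → ℕ} {e : ℕ} (h : ∀ x, f x ∈ phi e x) (k : ℕ) :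
    ∃ s, k ≤ agreement f e s := by
  induction k with
  | zero => exact ⟨0, Nat.zero_le _⟩
  | succ k ih =>
    obtain ⟨s, hs⟩ := ih
    obtain ⟨t, ht⟩ := Code.evaln_complete.1 (h k)
    refine ⟨max s t, le_agreement_iff.2 fun y hy => ?_⟩
    rcases (Nat.lt_succ_iff.1 hy).eq_or_lt with rfl | hlt
    · exact Code.evaln_mono (le_max_right _ _) ht
    · exact Code.evaln_mono (le_max_left _ _) (le_agreement_iff.1 hs y hlt)

/-- A bounded agreement is eventually constant. -/
lemma exists_agreement_eq {f : ℕ → ℕ} {e : ℕ} (h : ¬ ∀ x, f x ∈ phi e x) :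
    ∃ N, ∀ s ≥ N, agreement f e s = agreement f e N := by
  push Not at h
  obtain ⟨y, hy⟩ := h
  have hfin : (Set.range (agreement f e)).Finite :=
    (Set.finite_Iic y).subset (by rintro _ ⟨s, rfl⟩; exact agreement_le_of_not_mem hy s)
  obtain ⟨_, ⟨N, rfl⟩, hN⟩ := hfin.exists_maximal (Set.range_nonempty _)
  exact ⟨N, fun s hs => le_antisymm (hN ⟨s, rfl⟩ (agreement_mono f e hs)) (agreement_mono f e hs)⟩

lemma primrec_agreement :
    Primrec fun a : (List ℕ × ℕ) × ℕ => agreement (fun y => a.1.1.getD y 0) a.1.2 a.2 := by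
  refine primrec_boundedLeast ?_ Primrec.snd
  refine Primrec.not.comp (PrimrecPred.decide ?_)
  refine Primrec.eq.comp ?_ ?_
  · exact Code.primrec_evaln.comp
      (((Primrec.snd.comp Primrec.fst).pair
        ((Primrec.ofNat Code).comp (Primrec.snd.comp (Primrec.fst.comp Primrec.fst)))).pair
        Primrec.snd)
  · exact Primrec.option_some.comp ((Primrec.list_getD 0).comp
      (Primrec.fst.comp (Primrec.fst.comp Primrec.fst)) Primrec.snd)

/-- The least program below `e` whose agreement with `g` at time `x` exceeds that at time `j`,
or `e` if there is none. -/
def select (g : ℕ → ℕ) (e j x : ℕ) : ℕ :=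
  boundedLeast (fun d => decide (agreement g d j < agreement g d x)) e

/-- The function computed by the hypothesis with parameters `e` and `τ`: it outputs `τ` on the
domain of `τ`, and elsewhere it follows the selected program. -/
def hypothesis (a : (ℕ × List ℕ) × ℕ) : Part ℕ :=
  bif decide (a.2 < a.1.2.length) then Part.some (a.1.2.getD a.2 0)
  else phi (select (fun y => a.1.2.getD y 0) a.1.1 (a.1.2.length - 1) a.2) a.2

lemma partrec_hypothesis : Partrec hypothesis := by
  have hlen : Primrec fun a : (ℕ × List ℕ) × ℕ => a.1.2.length :=
    Primrec.list_length.comp (Primrec.snd.comp Primrec.fst)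
  have hsel : Primrec fun a : (ℕ × List ℕ) × ℕ =>
      select (fun y => a.1.2.getD y 0) a.1.1 (a.1.2.length - 1) a.2 := by
    refine primrec_boundedLeast (PrimrecPred.decide (Primrec.nat_lt.comp ?_ ?_))
      (Primrec.fst.comp Primrec.fst)
    · exact primrec_agreement.comp (((Primrec.snd.comp (Primrec.fst.comp Primrec.fst)).pair
        Primrec.snd).pair (Primrec.pred.comp (hlen.comp Primrec.fst)))
    · exact primrec_agreement.comp (((Primrec.snd.comp (Primrec.fst.comp Primrec.fst)).pair
        Primrec.snd).pair (Primrec.snd.comp Primrec.fst))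
  refine Partrec.cond (PrimrecPred.decide (Primrec.nat_lt.comp Primrec.snd hlen)).to_comp ?_ ?_
  · exact ((Primrec.list_getD 0).comp (Primrec.snd.comp Primrec.fst) Primrec.snd).to_comp
  · exact Code.eval_part.comp ((Primrec.ofNat Code).comp hsel).to_comp Computable.snd

/-- There is an injective computable assignment of indices to the hypotheses. -/
lemma exists_index : ∃ I : ℕ × List ℕ → ℕ, Computable I ∧ Function.Injective I ∧
    ∀ p x, phi (I p) x = hypothesis (p, x) := by
  obtain ⟨c, hc⟩ := Code.exists_code.1 partrec_hypothesis
  refine ⟨fun p => encode (c.curry (encode p)), ?_, ?_, fun p x => ?_⟩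
  · exact (Primrec.encode.comp (Code.primrec₂_curry.comp (Primrec.const c)
      Primrec.encode)).to_comp
  · exact fun p q h => encode_injective (Code.curry_inj (encode_injective h)).2
  · have : Nat.pair (encode p) x = encode (p, x) := rfl
    rw [phi, Denumerable.ofNat_encode, Code.eval_curry, hc, this]
    simp only [encodek]
    simp [Part.map_id']

/-- The least program whose agreement with `g` increases at stage `n`, or `n` if there is none. -/
def guess (g : ℕ → ℕ) (n : ℕ) : ℕ :=
  boundedLeast (fun e => decide (agreement g e (n - 1) < agreement g e n)) n

/-- The first stage from which the agreements of all programs below `e` keep the value they have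
at stage `n - 1`. -/
def settle (g : ℕ → ℕ) (n e : ℕ) : ℕ :=
  boundedLeast (fun j => decide (boundedLeast
    (fun d => !decide (agreement g d j = agreement g d (n - 1))) e = e)) (n - 1)

/-- The parameters of the hypothesis issued on the data `σ`. -/
def parameters (σ : List ℕ) : ℕ × List ℕ :=
  (guess (fun y => σ.getD y 0) σ.length,
    σ.take (settle (fun y => σ.getD y 0) σ.length (guess (fun y => σ.getD y 0) σ.length) + 1))

lemma primrec_parameters : Primrec parameters := by
  have hguess : Primrec fun σ : List ℕ => guess (fun y => σ.getD y 0) σ.length := by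
    refine primrec_boundedLeast (PrimrecPred.decide (Primrec.nat_lt.comp ?_ ?_))
      Primrec.list_length
    · exact primrec_agreement.comp
        (Primrec.id.pair (Primrec.pred.comp (Primrec.list_length.comp Primrec.fst)))
    · exact primrec_agreement.comp (Primrec.id.pair (Primrec.list_length.comp Primrec.fst))
  have hsettle : Primrec fun σ : List ℕ =>
      settle (fun y => σ.getD y 0) σ.length (guess (fun y => σ.getD y 0) σ.length) := by
    refine primrec_boundedLeast (PrimrecPred.decide (Primrec.eq.comp ?_ ?_))
      (Primrec.pred.comp Primrec.list_length)
    · refine primrec_boundedLeast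
        (Primrec.not.comp (PrimrecPred.decide (Primrec.eq.comp ?_ ?_)))
        (hguess.comp Primrec.fst)
      · exact primrec_agreement.comp (((Primrec.fst.comp Primrec.fst).pair Primrec.snd).pair
          (Primrec.snd.comp Primrec.fst))
      · exact primrec_agreement.comp (((Primrec.fst.comp Primrec.fst).pair Primrec.snd).pair
          (Primrec.pred.comp (Primrec.list_length.comp (Primrec.fst.comp Primrec.fst))))
    · exact hguess.comp Primrec.fst
  exact hguess.pair (Primrec.list_take.comp (Primrec.succ.comp hsettle) Primrec.id)

lemma settle_le (g : ℕ → ℕ) (n e : ℕ) : settle g n e ≤ n - 1 := boundedLeast_le _ _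

lemma boundedLeast_not_eq_self_iff {p : ℕ → Bool} {n : ℕ} :
    boundedLeast (fun i => !p i) n = n ↔ ∀ i < n, p i = true := by
  constructor
  · intro h i hi
    simpa using eq_false_of_lt_boundedLeast (p := fun i => !p i) (n := n) (h.symm ▸ hi)
  · exact fun h => boundedLeast_eq le_rfl (fun hlt => (lt_irrefl _ hlt).elim) (by simpa using h)

lemma agreement_settle (g : ℕ → ℕ) (n : ℕ) {e d : ℕ} (hd : d < e) :
    agreement g d (settle g n e) = agreement g d (n - 1) := by
  rcases (settle_le g n e).eq_or_lt with h | h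
  · rw [h]
  · have := boundedLeast_spec h
    rw [decide_eq_true_eq, boundedLeast_not_eq_self_iff] at this
    exact of_decide_eq_true (this d hd)

lemma settle_le_of {g : ℕ → ℕ} {n e j : ℕ}
    (h : ∀ d < e, agreement g d j = agreement g d (n - 1)) : settle g n e ≤ j := by
  refine boundedLeast_le_of ?_
  rw [decide_eq_true_eq, boundedLeast_not_eq_self_iff]
  simpa using h

lemma settle_congr {g h : ℕ → ℕ} {n : ℕ} (hgh : ∀ y < n, g y = h y) (e : ℕ) :
    settle g n e = settle h n e := by
  refine boundedLeast_congr fun j hj => ?_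
  have h₁ := agreement_congr (s := j) (fun y hy => hgh y (by omega))
  have h₂ := agreement_congr (s := n - 1) (fun y hy => hgh y (by omega))
  simp only [h₁, h₂]

lemma guess_congr {g h : ℕ → ℕ} {n : ℕ} (hgh : ∀ y < n, g y = h y) : guess g n = guess h n := by
  have h₁ := agreement_congr (s := n) hgh
  have h₂ := agreement_congr (s := n - 1) (fun y hy => hgh y (by omega))
  simp only [guess, h₁, h₂]

lemma length_fpref (f : ℕ → ℕ) (n : ℕ) : (fpref f n).length = n := by simp [fpref]

lemma getD_fpref (f : ℕ → ℕ) {n y : ℕ} (hy : y < n) : (fpref f n).getD y 0 = f y := by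
  simp [fpref, hy]

lemma take_fpref (f : ℕ → ℕ) {n k : ℕ} (hk : k ≤ n) : (fpref f n).take k = fpref f k := by
  simp [fpref, ← List.map_take, List.take_range, hk]

lemma parameters_fpref (f : ℕ → ℕ) {n : ℕ} (hn : 0 < n) :
    parameters (fpref f n) = (guess f n, fpref f (settle f n (guess f n) + 1)) := by
  have h : ∀ y < n, (fpref f n).getD y 0 = f y := fun y => getD_fpref f
  have hle := settle_le f n (guess f n)
  rw [parameters, length_fpref, guess_congr h, settle_congr h, take_fpref f (by omega)]

lemma hypothesis_fpref_of_le {f : ℕ → ℕ} {e j x : ℕ} (hx : x ≤ j) :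
    hypothesis ((e, fpref f (j + 1)), x) = Part.some (f x) := by
  have hx' : x < j + 1 := by omega
  simp only [hypothesis, length_fpref, hx', decide_true, cond_true, getD_fpref]

lemma hypothesis_fpref_of_lt {f : ℕ → ℕ} {e j x : ℕ} (hx : j < x) :
    hypothesis ((e, fpref f (j + 1)), x) = phi (select f e j x) x := by
  have hx' : ¬ x < j + 1 := by omega
  have hsel : select (fun y => (fpref f (j + 1)).getD y 0) e j x = select f e j x := by
    refine boundedLeast_congr fun d _ => ?_
    rw [decide_eq_decide]
    exact agreement_lt_iff_congr (fun y hy => getD_fpref f (by omega)) d x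
  simp only [hypothesis, length_fpref, hx', decide_false, cond_false, Nat.add_sub_cancel, hsel]

/-- If `e₀` computes `f` and the agreements of smaller programs do not grow beyond stage `j`, then
the hypothesis with parameters `e ≥ e₀` and `f(0), ..., f(j)` is correct at `x` as soon as
`e = e₀`, `x ≤ j`, or the agreement of `e₀` has grown between the stages `j` and `x`. -/
lemma mem_hypothesis {f : ℕ → ℕ} {e₀ e j x : ℕ} (he₀ : ∀ x, f x ∈ phi e₀ x) (he : e₀ ≤ e)
    (hj : ∀ d < e₀, ∀ s, agreement f d s ≤ agreement f d j)
    (h : e = e₀ ∨ x ≤ j ∨ agreement f e₀ j < agreement f e₀ x) :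
    f x ∈ hypothesis ((e, fpref f (j + 1)), x) := by
  rcases le_or_gt x j with hx | hx
  · rw [hypothesis_fpref_of_le hx]
    exact Part.mem_some _
  · have hsel : select f e j x = e₀ := by
      refine boundedLeast_eq he (fun hlt => decide_eq_true ?_) fun d hd => ?_
      · rcases h with h | h | h
        · omega
        · omega
        · exact h
      · exact decide_eq_false (hj d hd x).not_gt
    rw [hypothesis_fpref_of_lt hx, hsel]
    exact he₀ x

lemma infinite_setOf_agreement_lt {f : ℕ → ℕ} {e : ℕ} (he : ∀ x, f x ∈ phi e x) :
    {d | agreement f e d < agreement f e (d + 1)}.Infinite := by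
  refine Set.infinite_of_forall_exists_gt fun a => ?_
  by_contra! hno
  have hconst : ∀ s ≥ a + 1, agreement f e s ≤ agreement f e (a + 1) := by
    intro s hs
    induction s, hs using Nat.le_induction with
    | base => exact le_rfl
    | succ s hs ih =>
      by_contra! hlt
      exact absurd (hno s (ih.trans_lt hlt)) (by omega)
  obtain ⟨s, hs⟩ := exists_le_agreement he (agreement f e (a + 1) + 1)
  have h₁ := hconst (max s (a + 1)) (le_max_right _ _)
  have h₂ := agreement_mono f e (le_max_left s (a + 1))
  omega

/-- For the least program `e₀` of `f`, all agreements of smaller programs have reached their final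
values from some stage on. -/
lemma exists_stage {f : ℕ → ℕ} {e₀ : ℕ} (hmin : ∀ d < e₀, ¬ ∀ x, f x ∈ phi d x) :
    ∃ N, ∀ d < e₀, ∀ n ≥ N, ∀ s, agreement f d s ≤ agreement f d n := by
  have h : ∀ d < e₀, ∀ᶠ n in atTop, ∀ s, agreement f d s ≤ agreement f d n := by
    intro d hd
    obtain ⟨N, hN⟩ := exists_agreement_eq (hmin d hd)
    filter_upwards [eventually_ge_atTop N] with n hn s
    calc agreement f d s ≤ agreement f d (max s n) := agreement_mono f d (le_max_left _ _)
      _ = agreement f d n := by rw [hN _ (hn.trans (le_max_right _ _)), hN n hn]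
  have h' := (Set.finite_Iio e₀).eventually_all.2 h
  obtain ⟨N, hN⟩ := eventually_atTop.1 h'
  exact ⟨N, fun d hd n hn => hN n hn d hd⟩

/-- The sets on which the hypotheses are correct from stage `N` on: initial segments given by the
elements of an infinite set enumerated by `ν`, and successors of more and more of its elements. -/
def correctSet (N : ℕ) (ν : ℕ → ℕ) (n : ℕ) : Set ℕ :=
  {x | N ≤ n ∧ ((∃ i, x ≤ ν i ∧ ν i + 1 < n) ∨ ∃ k i, k ≤ n ∧ x = ν (Nat.pair k i) + 1)}

lemma correctSet_subset_succ (N : ℕ) (ν : ℕ → ℕ) (n : ℕ) :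
    correctSet N ν n ⊆ correctSet N ν (n + 1) := by
  rintro x ⟨hn, ⟨i, hx, hi⟩ | ⟨k, i, hk, hx⟩⟩
  · exact ⟨by omega, Or.inl ⟨i, hx, by omega⟩⟩
  · exact ⟨by omega, Or.inr ⟨k, i, by omega, hx⟩⟩

lemma iUnion_correctSet (N : ℕ) {ν : ℕ → ℕ} (hν : Function.Injective ν) :
    ⋃ n, correctSet N ν n = Set.univ := by
  refine Set.eq_univ_of_forall fun x => Set.mem_iUnion.2 ?_
  obtain ⟨_, ⟨i, rfl⟩, hi⟩ := (Set.infinite_range_of_injective hν).exists_gt x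
  exact ⟨max N (ν i + 2), le_max_left _ _, Or.inl ⟨i, hi.le, by omega⟩⟩

lemma infinite_setOf_infinite_correctSet_diff (N : ℕ) {ν : ℕ → ℕ} (hν : Function.Injective ν) :
    {n | (correctSet N ν (n + 1) \ correctSet N ν n).Infinite}.Infinite := by
  refine (Set.Ici_infinite N).mono fun n (hn : N ≤ n) => ?_
  have hinj : Function.Injective fun i => ν (Nat.pair (n + 1) i) + 1 := fun a b hab =>
    (Nat.pair_eq_pair.1 (hν (Nat.succ_injective hab))).2
  refine ((Set.infinite_range_of_injective hinj).sdiff (Set.finite_Iio n)).mono ?_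
  rintro _ ⟨⟨i, rfl⟩, hi⟩
  refine ⟨⟨by omega, Or.inr ⟨n + 1, i, le_rfl, rfl⟩⟩, ?_⟩
  rintro ⟨-, ⟨i', hle, hlt⟩ | ⟨k, i', hk, heq⟩⟩
  · exact hi (Set.mem_Iio.2 (by omega))
  · have := (Nat.pair_eq_pair.1 (hν (Nat.succ_injective heq))).1
    omega

end FunctionLearner

open FunctionLearner

/-- There is a single learner which BC*-learns, partially learns and
approximately learns every total recursive function. -/
theorem stmt0 :
    ∃ M : List ℕ → ℕ, Computable M ∧
      ∀ f : ℕ → ℕ, Computable f →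
        (∀ᶠ n in atTop, {x | ¬ f x ∈ phi (M (fpref f n)) x}.Finite) ∧
        (∃ e, {n | M (fpref f n) = e}.Infinite ∧
          (∀ x, phi e x = Part.some (f x)) ∧
          ∀ d, {n | M (fpref f n) = d}.Infinite → d = e) ∧
        ApproxLearnsFn M f := by
  obtain ⟨I, hI, hinj, hphi⟩ := exists_index
  refine ⟨fun σ => I (parameters σ), hI.comp primrec_parameters.to_comp, fun f hf => ?_⟩
  have hex : ∃ e, ∀ x, f x ∈ phi e x := by
    obtain ⟨c, hc⟩ := Code.exists_code.1 (Partrec.nat_iff.1 hf.partrec)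
    exact ⟨encode c, fun x => by simp [phi, hc]⟩
  classical
  obtain ⟨e₀, he₀, hmin⟩ : ∃ e₀, (∀ x, f x ∈ phi e₀ x) ∧ ∀ d < e₀, ¬ ∀ x, f x ∈ phi d x :=
    ⟨Nat.find hex, Nat.find_spec hex, fun d => Nat.find_min hex⟩
  obtain ⟨N₀, hN₀⟩ := exists_stage hmin
  obtain ⟨N, hNe, hNN⟩ : ∃ N, e₀ < N ∧ N₀ < N := ⟨max e₀ N₀ + 1, by omega, by omega⟩
  let e : ℕ → ℕ := guess f
  let j : ℕ → ℕ := fun n => settle f n (e n)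
  have hM : ∀ n ≥ N, I (parameters (fpref f n)) = I (e n, fpref f (j n + 1)) := fun n hn => by
    rw [parameters_fpref f (by omega)]
  have hfinal : ∀ d < e₀, ∀ n ≥ N, ∀ m ≥ N,
      agreement f d (n - 1) = agreement f d (m - 1) := fun d hd n hn m hm =>
    le_antisymm (hN₀ d hd _ (by omega) _) (hN₀ d hd _ (by omega) _)
  have he : ∀ n ≥ N, e₀ ≤ e n := fun n hn =>
    le_boundedLeast (by omega) fun d hd => decide_eq_false (hN₀ d hd _ (by omega) _).not_gt
  have hj : ∀ n ≥ N, ∀ d < e₀, ∀ s, agreement f d s ≤ agreement f d (j n) := fun n hn d hd s => by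
    rw [agreement_settle f n (hd.trans_le (he n hn))]
    exact hN₀ d hd _ (by omega) s
  have hsettle : ∀ n ≥ N, ∀ m ≥ N, settle f n e₀ ≤ settle f m e₀ := fun n hn m hm =>
    settle_le_of fun d hd => by rw [agreement_settle f m hd, hfinal d hd m hm n hn]
  have hj_eq : ∀ n ≥ N, e n = e₀ → j n = settle f N e₀ := fun n hn hen => by
    simp only [j, hen]
    exact le_antisymm (hsettle n hn N le_rfl) (hsettle N le_rfl n hn)
  have hcorrect : ∀ n ≥ N, ∀ x,
      (e n = e₀ ∨ x ≤ j n ∨ agreement f e₀ (j n) < agreement f e₀ x) →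
      f x ∈ phi (I (parameters (fpref f n))) x := fun n hn x h => by
    rw [hM n hn, hphi]
    exact mem_hypothesis he₀ (he n hn) (hj n hn) h
  have hD := infinite_setOf_agreement_lt he₀
  have hlt_j : ∀ n ≥ N, e n ≠ e₀ → ∀ d, agreement f e₀ d < agreement f e₀ (d + 1) → d + 1 < n →
      d < j n := fun n hn hen d hd hdn => by
    by_contra! hle
    have h₁ := agreement_mono f e₀ hle
    have h₂ := agreement_settle f n (lt_of_le_of_ne (he n hn) (Ne.symm hen))
    have h₃ := agreement_mono f e₀ (show d + 1 ≤ n - 1 by omega)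
    simp only [j, e] at *
    omega
  refine ⟨?_, ⟨I (e₀, fpref f (settle f N e₀ + 1)), ?_, ?_, ?_⟩, ?_⟩
  · filter_upwards [eventually_ge_atTop N] with n hn
    obtain ⟨s, hs⟩ := exists_le_agreement he₀ (agreement f e₀ (j n) + 1)
    refine (Set.finite_Iio s).subset fun x hx => ?_
    by_contra hxs
    have hmono := agreement_mono f e₀ (not_lt.1 hxs)
    exact hx (hcorrect n hn x (Or.inr (Or.inr (by omega))))
  · refine Set.infinite_of_forall_exists_gt fun a => ?_
    obtain ⟨d, hd, had⟩ := hD.exists_gt (max a N)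
    have hen : e (d + 1) = e₀ := boundedLeast_eq (by omega) (fun _ => decide_eq_true hd)
      fun i hi => decide_eq_false (hN₀ i hi _ (by omega) _).not_gt
    refine ⟨d + 1, ?_, by omega⟩
    change I _ = I _
    rw [hM _ (by omega), hen, hj_eq _ (by omega) hen]
  · intro x
    rw [hphi]
    refine Part.eq_some_iff.2 (mem_hypothesis he₀ le_rfl (fun d hd s => ?_) (Or.inl rfl))
    rw [agreement_settle f N hd]
    exact hN₀ d hd _ (by omega) s
  · intro d hd
    obtain ⟨n, hn, hNn⟩ := hd.exists_gt N
    change I _ = d at hn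
    rw [hM n hNn.le] at hn
    rcases eq_or_ne (e n) e₀ with hen | hen
    · rw [← hn, hen, hj_eq n hNn.le hen]
    · exfalso
      obtain ⟨s, hs, hjs⟩ := hD.exists_gt (j n)
      obtain ⟨m, hm, hlt⟩ := hd.exists_gt (max N (s + 1))
      change I _ = d at hm
      rw [hM m (by omega), ← hn] at hm
      obtain ⟨hem, hpref⟩ := Prod.mk.inj (hinj hm)
      have hlen := congrArg List.length hpref
      rw [length_fpref, length_fpref] at hlen
      have := hlt_j m (by omega) (hem ▸ hen) s hs (by omega)
      omega
  · let ν : ℕ → ℕ := fun i => hD.natEmbedding _ i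
    have hν : Function.Injective ν := Subtype.val_injective.comp (hD.natEmbedding _).injective
    have hνD : ∀ i, agreement f e₀ (ν i) < agreement f e₀ (ν i + 1) := fun i =>
      (hD.natEmbedding _ i).2
    refine ⟨correctSet N ν, correctSet_subset_succ N ν, iUnion_correctSet N hν,
      infinite_setOf_infinite_correctSet_diff N hν, ?_⟩
    rintro n x ⟨hn, hx⟩
    refine hcorrect n hn x (or_iff_not_imp_left.2 fun hen => ?_)
    rcases hx with ⟨i, hxi, hi⟩ | ⟨k, i, -, rfl⟩
    · exact Or.inl (hxi.trans (hlt_j n hn hen _ (hνD i) hi).le)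
    · rcases lt_or_ge (ν (Nat.pair k i)) (j n) with hlt | hge
      · exact Or.inl hlt
      · exact Or.inr ((agreement_mono f e₀ hge).trans_lt (hνD _))
end

section
/- A learner M approximately (Approx) learns a total recursive function f if and only if the following two conditions hold, where e_n = M(f(0),...,f(n-1)): (d) for every x ∈ ℕ and almost all n, φ_{e_n}(x) = f(x); and (e) there is an infinite set S ⊆ ℕ such that for almost all n and all x ∈ S, φ_{e_n}(x) = f(x). -/
open Filter

/-- An infinite set of naturals can be split into infinitely many infinite pieces. -/
theorem exists_infinite_fibers {S : Set ℕ} (hS : S.Infinite) :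
    ∃ c : ℕ → ℕ, ∀ a, {x | x ∈ S ∧ c x = a}.Infinite := by
  let e : ℕ → ℕ := fun i => hS.natEmbedding S i
  have he : Function.Injective e :=
    Subtype.val_injective.comp (hS.natEmbedding S).injective
  refine ⟨fun x => (Nat.unpair (Function.invFun e x)).1, fun a => ?_⟩
  refine Set.infinite_of_injective_forall_mem (f := fun b => e (Nat.pair a b)) ?_ fun b => ?_
  · intro b b' h
    exact (Nat.pair_eq_pair.mp (he h)).2
  · exact ⟨(hS.natEmbedding S _).2, by simp [Function.leftInverse_invFun he _]⟩

/-- A relation `P` admits an ascending cover of `ℕ` by sets `S n` with `P n` valid on `S n` and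
infinitely many infinite increments iff it eventually holds at each point and eventually holds
uniformly on some infinite set. -/
theorem exists_ascending_cover_iff (P : ℕ → ℕ → Prop) :
    (∃ S : ℕ → Set ℕ, (∀ n, S n ⊆ S (n + 1)) ∧ (⋃ n, S n) = Set.univ ∧
      {n | (S (n + 1) \ S n).Infinite}.Infinite ∧ ∀ n, ∀ x ∈ S n, P n x) ↔
    (∀ x, ∀ᶠ n in atTop, P n x) ∧
      ∃ S : Set ℕ, S.Infinite ∧ ∀ᶠ n in atTop, ∀ x ∈ S, P n x := by
  classical
  constructor
  · rintro ⟨S, hmono, hcover, hinf, hP⟩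
    have hS : Monotone S := monotone_nat_of_le_succ hmono
    refine ⟨fun x => ?_, ?_⟩
    · obtain ⟨m, hm⟩ := Set.mem_iUnion.mp (hcover ▸ Set.mem_univ x)
      filter_upwards [eventually_ge_atTop m] with n hn
      exact hP n x (hS hn hm)
    · obtain ⟨m, hm⟩ := hinf.nonempty
      refine ⟨S (m + 1), hm.mono Set.sdiff_subset, ?_⟩
      filter_upwards [eventually_ge_atTop (m + 1)] with n hn x hx
      exact hP n x (hS hn hx)
  · rintro ⟨hpt, S, hS, hunif⟩
    obtain ⟨N, hN⟩ := eventually_atTop.mp hunif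
    choose t ht using fun x => eventually_atTop.mp (hpt x)
    obtain ⟨c, hc⟩ := exists_infinite_fibers hS
    let g : ℕ → ℕ := fun x => if x ∈ S then N + c x + 1 else t x
    refine ⟨fun n => {x | g x ≤ n}, fun n x hx => Nat.le_succ_of_le hx, ?_, ?_, fun n x hx => ?_⟩
    · exact Set.eq_univ_of_forall fun x => Set.mem_iUnion.mpr ⟨g x, le_refl (g x)⟩
    · refine Set.infinite_of_injective_forall_mem (f := fun a => N + a)
        (add_right_injective N) fun a => (hc a).mono ?_
      rintro x ⟨hxS, rfl⟩
      simp [g, hxS]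
    · by_cases hxS : x ∈ S
      · have hx' : N + c x + 1 ≤ n := by simpa [g, hxS] using hx
        exact hN n (by omega) x hxS
      · exact ht x n (by simpa [g, hxS] using hx)

/-- `M` Approx-learns a recursive function `f` iff (d) for every `x` almost all
hypotheses are correct at `x`, and (e) there is an infinite set `S` such that
almost all hypotheses are correct on all of `S`. -/
theorem stmt1 (M : List ℕ → ℕ) (hM : Computable M) (f : ℕ → ℕ) (hf : Computable f) :
    ApproxLearnsFn M f ↔
      ((∀ x : ℕ, ∀ᶠ n in atTop, f x ∈ phi (M (fpref f n)) x) ∧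
       (∃ S : Set ℕ, S.Infinite ∧
          ∀ᶠ n in atTop, ∀ x ∈ S, f x ∈ phi (M (fpref f n)) x)) := by
  exact exists_ascending_cover_iff fun n x => f x ∈ phi (M (fpref f n)) x
end

section
/- There is a single learner M which both partially (Part) learns and finitely approximately (FinApprox) learns the class of all recursively enumerable subsets of ℕ. -/
open Filter

/-- The `e`-th recursively enumerable set, `W_e = dom(φ_e)`. -/
def Wset (e : ℕ) : Set ℕ := (phi e).Dom

/-- `T` is a text for `L`: the natural numbers occurring in `T` are exactly
the members of `L` (`none` plays the role of the pause symbol `#`). -/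
def IsText (T : ℕ → Option ℕ) (L : Set ℕ) : Prop :=
  {x : ℕ | ∃ n, T n = some x} = L

/-- The finite sequence `T[n] = T(0), ..., T(n-1)`. -/
def pref (T : ℕ → Option ℕ) (n : ℕ) : List (Option ℕ) :=
  (List.range n).map T

/-- `M` partially (Part) learns `C`: on every text for every `L ∈ C` there is
exactly one index output infinitely often, and that index is an index of `L`. -/
def PartLearns (M : List (Option ℕ) → ℕ) (C : Set (Set ℕ)) : Prop :=
  ∀ L ∈ C, ∀ T : ℕ → Option ℕ, IsText T L →
    ∃ e, {n | M (pref T n) = e}.Infinite ∧ Wset e = L ∧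
      ∀ d, {n | M (pref T n) = d}.Infinite → d = e

/-- `M` is consistent (Cons): every number occurring in `σ` belongs to `W_{M(σ)}`. -/
def ConsLearner (M : List (Option ℕ) → ℕ) : Prop :=
  ∀ σ : List (Option ℕ), ∀ x : ℕ, some x ∈ σ → x ∈ Wset (M σ)

/-- `M` finitely approximately (FinApprox) learns `C`. -/
def FinApproxLearns (M : List (Option ℕ) → ℕ) (C : Set (Set ℕ)) : Prop :=
  ∀ L ∈ C, ∀ T : ℕ → Option ℕ, IsText T L → ∀ D : Finset ℕ,
    ∀ᶠ n in atTop, Wset (M (pref T n)) ∩ ↑D = L ∩ ↑D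

/-- `M` BC*-learns `C`: almost all hypotheses are finite variants of the target. -/
def BCstarLearns (M : List (Option ℕ) → ℕ) (C : Set (Set ℕ)) : Prop :=
  ∀ L ∈ C, ∀ T : ℕ → Option ℕ, IsText T L →
    ∀ᶠ n in atTop, (symmDiff (Wset (M (pref T n))) L).Finite

/-- `M` BC^k-learns `C`: almost all hypotheses differ from the target in at
most `k` elements. -/
def BCnLearns (k : ℕ) (M : List (Option ℕ) → ℕ) (C : Set (Set ℕ)) : Prop :=
  ∀ L ∈ C, ∀ T : ℕ → Option ℕ, IsText T L →
    ∀ᶠ m in atTop, (symmDiff (Wset (M (pref T m))) L).Finite ∧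
      (symmDiff (Wset (M (pref T m))) L).ncard ≤ k

/-- `M` behaviourally correctly (BC) learns `C`. -/
def BCLearns (M : List (Option ℕ) → ℕ) (C : Set (Set ℕ)) : Prop :=
  ∀ L ∈ C, ∀ T : ℕ → Option ℕ, IsText T L →
    ∀ᶠ n in atTop, Wset (M (pref T n)) = L

/-- `M` explanatorily (Ex) learns `C`. -/
def ExLearns (M : List (Option ℕ) → ℕ) (C : Set (Set ℕ)) : Prop :=
  ∀ L ∈ C, ∀ T : ℕ → Option ℕ, IsText T L →
    ∃ e n₀, Wset e = L ∧ ∀ n ≥ n₀, M (pref T n) = e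

/-- `M` weakly approximately (WeakApprox) learns `C`: for every text there is
an infinite set `W` such that on every finite variant `V` of `W` almost all
hypotheses agree with the target. -/
def WeakApproxLearns (M : List (Option ℕ) → ℕ) (C : Set (Set ℕ)) : Prop :=
  ∀ L ∈ C, ∀ T : ℕ → Option ℕ, IsText T L →
    ∃ W : Set ℕ, W.Infinite ∧ ∀ V : Set ℕ, (symmDiff V W).Finite →
      ∀ᶠ n in atTop, Wset (M (pref T n)) ∩ V = L ∩ V

/-- `M` approximately (Approx) learns `C`: for every `L ∈ C` there is an
infinite set `W`, good for all texts for `L`. -/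
def ApproxLearns (M : List (Option ℕ) → ℕ) (C : Set (Set ℕ)) : Prop :=
  ∀ L ∈ C, ∃ W : Set ℕ, W.Infinite ∧ ∀ T : ℕ → Option ℕ, IsText T L →
    ∀ V : Set ℕ, (symmDiff V W).Finite →
      ∀ᶠ n in atTop, Wset (M (pref T n)) ∩ V = L ∩ V

/-- Conservativeness for partial learners: on each text for every `L ∈ C`, `M`
outputs exactly one index `e` with `L ⊆ W_e`. -/
def ConsvLearner (M : List (Option ℕ) → ℕ) (C : Set (Set ℕ)) : Prop :=
  ∀ L ∈ C, ∀ T : ℕ → Option ℕ, IsText T L →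
    ∃! e, (∃ n, M (pref T n) = e) ∧ L ⊆ Wset e

/-- Confidence: on every infinite sequence, `M` outputs exactly one index
infinitely often. -/
def Confident (M : List (Option ℕ) → ℕ) : Prop :=
  ∀ T : ℕ → Option ℕ, ∃! e, {n | M (pref T n) = e}.Infinite

/-- The sets ever conjectured by `M` (used to express prudence). -/
def Conjectured (M : List (Option ℕ) → ℕ) : Set (Set ℕ) :=
  {S | ∃ σ : List (Option ℕ), S = Wset (M σ)}

open Nat.Partrec (Code)

section Construction

/-- The `σ.length`-step approximation of `W_e` coincides with the content of `σ` below `x`. -/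
def Agree (e x : ℕ) (σ : List (Option ℕ)) : Prop :=
  x ≤ σ.length ∧ ∀ y < x,
    (Code.evaln σ.length (Denumerable.ofNat Code e) y).isSome = decide (some y ∈ σ)

instance (e x : ℕ) (σ : List (Option ℕ)) : Decidable (Agree e x σ) :=
  inferInstanceAs (Decidable (_ ∧ _))

/-- `W_e` agrees with `σ` up to a bound that was never reached on a proper prefix of `σ`. -/
def Gain (e : ℕ) (σ : List (Option ℕ)) : Prop :=
  ∃ x < σ.length + 1, Agree e x σ ∧ ∀ m < σ.length, ¬ Agree e x (σ.take m)

instance (e : ℕ) (σ : List (Option ℕ)) : Decidable (Gain e σ) :=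
  inferInstanceAs (Decidable (∃ _ < _, _))

/-- The least `e < σ.length` with a gain at `σ`, or `σ.length` if there is none. -/
def pick (σ : List (Option ℕ)) : ℕ :=
  (List.range σ.length).findIdx fun e => decide (Gain e σ)

/-- The last earlier stage at which an index below `e` was picked. -/
def lastBelow (e : ℕ) (σ : List (Option ℕ)) : ℕ :=
  Nat.findGreatest (fun m => m < σ.length ∧ pick (σ.take m) < e) σ.length

/-- The characteristic table, of length `k`, of the content of `σ`. -/
def contentTable (k : ℕ) (σ : List (Option ℕ)) : List Bool :=
  (List.range k).map fun y => decide (some y ∈ σ)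

end Construction

section Computability

open Primrec

theorem PrimrecRel.ball_lt {β : Type*} [Primcodable β] {R : ℕ → β → Prop} (hR : PrimrecRel R) :
    PrimrecRel fun n b => ∀ x < n, R x b :=
  (hR.forall_mem_list.comp (list_range.comp fst) snd).of_eq (by simp)

theorem PrimrecRel.bex_lt {β : Type*} [Primcodable β] {R : ℕ → β → Prop} (hR : PrimrecRel R) :
    PrimrecRel fun n b => ∃ x < n, R x b :=
  (hR.exists_mem_list.comp (list_range.comp fst) snd).of_eq (by simp)

theorem primrecRel_some_mem : PrimrecRel fun (σ : List (Option ℕ)) (y : ℕ) => some y ∈ σ := by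
  have h : PrimrecRel fun (a : Option ℕ) (y : ℕ) => a = some y :=
    Primrec.eq.comp fst (option_some.comp snd)
  exact h.exists_mem_list.of_eq (by simp)

theorem primrecPred_agree :
    PrimrecPred fun p : ℕ × ℕ × List (Option ℕ) => Agree p.1 p.2.1 p.2.2 := by
  have hσ : Primrec fun p : ℕ × ℕ × List (Option ℕ) => p.2.2 := snd.comp snd
  have hR : PrimrecRel fun (y : ℕ) (p : ℕ × ℕ × List (Option ℕ)) =>
      (Code.evaln p.2.2.length (Denumerable.ofNat Code p.1) y).isSome
        = decide (some y ∈ p.2.2) := by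
    refine Primrec.eq.comp (option_isSome.comp (Code.primrec_evaln.comp
      (((list_length.comp (hσ.comp snd)).pair
        ((Primrec.ofNat Code).comp (fst.comp snd))).pair fst))) ?_
    exact (primrecRel_some_mem.comp (hσ.comp snd) fst).decide
  exact (Primrec.nat_le.comp (fst.comp snd) (list_length.comp hσ)).and
    (hR.ball_lt.comp (fst.comp snd) Primrec.id)

theorem primrecRel_gain : PrimrecRel Gain := by
  have hσ : Primrec fun p : ℕ × ℕ × List (Option ℕ) => p.2.2 := snd.comp snd
  have hprev : PrimrecRel fun (m : ℕ) (p : ℕ × ℕ × List (Option ℕ)) =>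
      ¬ Agree p.1 p.2.1 (p.2.2.take m) :=
    (primrecPred_agree.comp ((fst.comp snd).pair
      (((fst.comp snd).comp snd).pair (list_take.comp fst (hσ.comp snd))))).not
  have hnew : PrimrecPred fun p : ℕ × ℕ × List (Option ℕ) =>
      Agree p.1 p.2.1 p.2.2 ∧ ∀ m < p.2.2.length, ¬ Agree p.1 p.2.1 (p.2.2.take m) :=
    primrecPred_agree.and (hprev.ball_lt.comp (list_length.comp hσ) Primrec.id)
  have hR : PrimrecRel fun (x : ℕ) (q : ℕ × List (Option ℕ)) =>
      Agree q.1 x q.2 ∧ ∀ m < q.2.length, ¬ Agree q.1 x (q.2.take m) :=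
    hnew.comp ((fst.comp snd).pair (fst.pair (snd.comp snd)))
  exact hR.bex_lt.comp (succ.comp (list_length.comp snd)) Primrec.id

theorem primrec_pick : Primrec pick :=
  list_findIdx (list_range.comp list_length) (primrecRel_gain.comp snd fst).decide

theorem primrec_lastBelow : Primrec₂ lastBelow := by
  refine nat_findGreatest (p := fun (q : ℕ × List (Option ℕ)) m =>
    m < q.2.length ∧ pick (q.2.take m) < q.1) (list_length.comp snd) ?_
  have hσ : Primrec fun r : (ℕ × List (Option ℕ)) × ℕ => r.1.2 := snd.comp fst
  exact (nat_lt.comp snd (list_length.comp hσ)).and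
    (nat_lt.comp (primrec_pick.comp (list_take.comp snd hσ)) (fst.comp fst))

theorem primrec_contentTable : Primrec₂ contentTable :=
  list_map (list_range.comp fst) (primrecRel_some_mem.comp (snd.comp fst) snd).decide

/-- An injective primitive recursive way to overwrite an initial segment of `W_e` by a table. -/
theorem exists_patch : ∃ h : ℕ → List Bool → ℕ, Primrec₂ h ∧
    (∀ e F e' F', h e F = h e' F' → F = F') ∧
    ∀ e F y, y ∈ Wset (h e F) ↔ F[y]? = some true ∨ (F[y]? = none ∧ y ∈ Wset e) := by
  let f : (ℕ × List Bool) × ℕ →. ℕ := fun p =>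
    bif (p.1.2[p.2]?).isSome then
      (bif decide (p.1.2[p.2]? = some true) then Part.some 0 else Part.none)
    else Code.eval (Denumerable.ofNat Code p.1.1) p.2
  have hget : Primrec fun p : (ℕ × List Bool) × ℕ => p.1.2[p.2]? :=
    list_getElem?.comp (snd.comp fst) snd
  have hf : Partrec f := by
    refine Partrec.cond (option_isSome.comp hget).to_comp (Partrec.cond
      (Primrec.eq.comp hget (const (some true))).decide.to_comp
      (Computable.const 0) Partrec.none) ?_
    exact Code.eval_part.comp ((Primrec.ofNat Code).comp (fst.comp fst)).to_comp
      Computable.snd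
  obtain ⟨c, hc⟩ := Code.exists_code.1 hf
  refine ⟨fun e F => Encodable.encode (Code.curry c (Encodable.encode (e, F))), ?_, ?_, ?_⟩
  · exact Primrec.encode.comp (Code.primrec₂_curry.comp (const c) Primrec.encode)
  · intro e F e' F' h
    have h₁ := (Code.curry_inj (Encodable.encode_injective h)).2
    exact (Prod.mk.inj (Encodable.encode_injective h₁)).2
  · intro e F y
    have hev : Code.eval (Code.curry c (Encodable.encode (e, F))) y
        = (f ((e, F), y)).map Encodable.encode := by
      rw [Code.eval_curry, hc]
      simp
    have hmem : y ∈ Wset (Encodable.encode (Code.curry c (Encodable.encode (e, F))))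
        ↔ (f ((e, F), y)).Dom := by
      change (Code.eval (Denumerable.ofNat Code (Encodable.encode _)) y).Dom ↔ _
      rw [Denumerable.ofNat_encode, hev]
      rfl
    rw [hmem]
    rcases hF : F[y]? with _ | b
    · simp only [f, hF]
      simp [Wset, phi, PFun.mem_dom, Part.dom_iff_mem]
    · cases b <;> simp [f, hF]

end Computability

section Convergence

variable {T : ℕ → Option ℕ} {L : Set ℕ}

theorem length_pref (T : ℕ → Option ℕ) (n : ℕ) : (pref T n).length = n := by simp [pref]

theorem take_pref (T : ℕ → Option ℕ) {m n : ℕ} (h : m ≤ n) :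
    (pref T n).take m = pref T m := by
  simp [pref, ← List.map_take, List.take_range, h]

theorem eventually_mem_pref_iff (hT : IsText T L) (y : ℕ) :
    ∀ᶠ n in atTop, (some y ∈ pref T n ↔ y ∈ L) := by
  subst hT
  by_cases hy : ∃ m, T m = some y
  · obtain ⟨m, hm⟩ := hy
    filter_upwards [eventually_gt_atTop m] with n hn
    simp only [pref, List.mem_map, List.mem_range]
    exact iff_of_true ⟨m, hn, hm⟩ ⟨m, hm⟩
  · refine Eventually.of_forall fun n => ?_
    simp only [pref, List.mem_map, List.mem_range]
    exact iff_of_false (fun ⟨m, _, hm⟩ => hy ⟨m, hm⟩) hy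

theorem eventually_isSome_evaln_iff (e y : ℕ) :
    ∀ᶠ n in atTop,
      ((Code.evaln n (Denumerable.ofNat Code e) y).isSome = true ↔ y ∈ Wset e) := by
  by_cases hy : y ∈ Wset e
  · obtain ⟨v, hv⟩ := Part.dom_iff_mem.1 hy
    obtain ⟨k, hk⟩ := Code.evaln_complete.1 hv
    filter_upwards [eventually_ge_atTop k] with n hn
    exact iff_of_true (Option.isSome_iff_exists.2 ⟨v, Code.evaln_mono hn hk⟩) hy
  · refine Eventually.of_forall fun n => iff_of_false (fun h => hy ?_) hy
    obtain ⟨v, hv⟩ := Option.isSome_iff_exists.1 h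
    exact Part.dom_iff_mem.2 ⟨v, Code.evaln_sound hv⟩

theorem eventually_forall_lt {p : ℕ → ℕ → Prop} (h : ∀ y, ∀ᶠ n in atTop, p y n) (k : ℕ) :
    ∀ᶠ n in atTop, ∀ y < k, p y n :=
  (eventually_all_finite (Set.finite_lt_nat k)).2 fun y _ => h y

theorem eventually_agree (hT : IsText T L) {e : ℕ} (he : Wset e = L) (x : ℕ) :
    ∀ᶠ n in atTop, Agree e x (pref T n) := by
  filter_upwards [eventually_ge_atTop x,
    eventually_forall_lt (eventually_mem_pref_iff hT) x,
    eventually_forall_lt (eventually_isSome_evaln_iff e) x] with n hn h₁ h₂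
  refine ⟨by rwa [length_pref], fun y hy => ?_⟩
  rw [Bool.eq_iff_iff, length_pref, h₂ y hy, decide_eq_true_iff, h₁ y hy, he]

theorem gain_pref_iff (e n : ℕ) : Gain e (pref T n) ↔
    ∃ x < n + 1, Agree e x (pref T n) ∧ ∀ m < n, ¬ Agree e x (pref T m) := by
  simp only [Gain, length_pref]
  refine exists_congr fun x => and_congr_right fun _ => and_congr_right fun _ =>
    forall₂_congr fun m hm => ?_
  rw [take_pref T hm.le]

theorem frequently_gain (hT : IsText T L) {e : ℕ} (he : Wset e = L) :
    ∃ᶠ n in atTop, Gain e (pref T n) := by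
  classical
  refine frequently_atTop.2 fun x => ?_
  have hex : ∃ n, Agree e x (pref T n) := (eventually_agree hT he x).exists
  have hx : x ≤ Nat.find hex := by
    simpa only [length_pref] using (Nat.find_spec hex).1
  exact ⟨Nat.find hex, hx, (gain_pref_iff _ _).2
    ⟨x, Nat.lt_succ_of_le hx, Nat.find_spec hex, fun m hm => Nat.find_min hex hm⟩⟩

theorem eventually_not_gain (hT : IsText T L) {e : ℕ} (he : Wset e ≠ L) :
    ∀ᶠ n in atTop, ¬ Gain e (pref T n) := by
  obtain ⟨y, hy⟩ : ∃ y, ¬ (y ∈ Wset e ↔ y ∈ L) := by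
    by_contra! h
    exact he (Set.ext h)
  have hfirst (x : ℕ) : ∀ᶠ n in atTop,
      ¬ (Agree e x (pref T n) ∧ ∀ m < n, ¬ Agree e x (pref T m)) := by
    by_cases hx : ∃ m, Agree e x (pref T m)
    · obtain ⟨m, hm⟩ := hx
      filter_upwards [eventually_gt_atTop m] with n hn h using h.2 m hn hm
    · exact Eventually.of_forall fun n h => hx ⟨n, h.1⟩
  filter_upwards [eventually_mem_pref_iff hT y, eventually_isSome_evaln_iff e y,
    eventually_forall_lt hfirst (y + 1)] with n h₁ h₂ h₃ hg
  obtain ⟨x, -, hx⟩ := (gain_pref_iff _ _).1 hg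
  rcases lt_or_ge x (y + 1) with hxy | hxy
  · exact h₃ x hxy hx
  · have := hx.1.2 y hxy
    rw [Bool.eq_iff_iff, length_pref, h₂, decide_eq_true_iff, h₁] at this
    exact hy this

theorem gain_pick {σ : List (Option ℕ)} (h : pick σ < σ.length) : Gain (pick σ) σ := by
  have := List.findIdx_getElem (xs := List.range σ.length)
    (p := fun e => decide (Gain e σ)) (w := by simpa [pick] using h)
  simpa [pick] using this

theorem pick_le {e : ℕ} {σ : List (Option ℕ)} (hg : Gain e σ) :
    pick σ ≤ e := by
  by_contra! h
  have := List.not_of_lt_findIdx (xs := List.range σ.length)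
    (p := fun e => decide (Gain e σ)) h
  simp [hg] at this

/-- Along a text for an r.e. set, picks settle on the least index as their limit inferior. -/
theorem exists_pick_limit (hT : IsText T L) (hL : ∃ e, Wset e = L) :
    ∃ e, Wset e = L ∧ (∃ᶠ n in atTop, pick (pref T n) = e) ∧
      ∀ᶠ n in atTop, e ≤ pick (pref T n) := by
  classical
  have hlow : ∀ᶠ n in atTop, Nat.find hL ≤ pick (pref T n) := by
    have hno : ∀ i, ∀ᶠ n in atTop, i < Nat.find hL → ¬ Gain i (pref T n) := fun i => by
      by_cases hi : i < Nat.find hL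
      · filter_upwards [eventually_not_gain hT (Nat.find_min hL hi)] with n hn _ using hn
      · exact Eventually.of_forall fun n h => absurd h hi
    filter_upwards [eventually_forall_lt hno (Nat.find hL),
      eventually_ge_atTop (Nat.find hL)] with n h hn
    by_contra! hlt
    exact h _ hlt hlt (gain_pick (by rw [length_pref]; exact hlt.trans_le hn))
  refine ⟨Nat.find hL, Nat.find_spec hL, ?_, hlow⟩
  refine ((frequently_gain hT (Nat.find_spec hL)).and_eventually hlow).mono fun n hn => ?_
  exact le_antisymm (pick_le hn.1) hn.2

theorem exists_lastBelow_eq {e : ℕ} (he : ∀ᶠ n in atTop, e ≤ pick (pref T n)) :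
    ∃ K, ∀ᶠ n in atTop, lastBelow e (pref T n) = K := by
  obtain ⟨N, hN⟩ := eventually_atTop.1 he
  obtain ⟨hle, hspec, hmax⟩ := (Nat.findGreatest_eq_iff
    (P := fun m => pick (pref T m) < e) (k := N)).1 rfl
  refine ⟨Nat.findGreatest (fun m => pick (pref T m) < e) N, ?_⟩
  filter_upwards [eventually_gt_atTop N] with n hn
  refine Nat.findGreatest_eq_iff.2 ⟨by rw [length_pref]; exact hle.trans hn.le, ?_, ?_⟩
  · intro h0
    rw [length_pref, take_pref T (hle.trans hn.le)]
    exact ⟨hle.trans_lt hn, hspec h0⟩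
  · rintro m hm - ⟨hmn, hlt⟩
    rw [length_pref] at hmn
    rw [take_pref T hmn.le] at hlt
    rcases le_or_gt m N with h | h
    · exact hmax hm h hlt
    · exact (hN m h.le).not_gt hlt

theorem eventually_le_lastBelow {e : ℕ} (he : ∃ᶠ n in atTop, pick (pref T n) = e) (k : ℕ) :
    ∀ᶠ n in atTop, ∀ d > e, k ≤ lastBelow d (pref T n) := by
  obtain ⟨m, hkm, hm⟩ := frequently_atTop.1 he k
  filter_upwards [eventually_gt_atTop m] with n hn d hd
  refine hkm.trans (Nat.le_findGreatest (by rw [length_pref]; exact hn.le) ?_)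
  rw [length_pref, take_pref T hn.le, hm]
  exact ⟨hn, hd⟩

end Convergence

theorem getElem?_contentTable (k y : ℕ) (σ : List (Option ℕ)) :
    (contentTable k σ)[y]? = if y < k then some (decide (some y ∈ σ)) else none := by
  split_ifs with h <;> simp [contentTable, h]

/-- There is a single learner which both partially and finitely approximately
learns the class of all r.e. subsets of ℕ. -/
theorem stmt2 :
    ∃ M : List (Option ℕ) → ℕ, Computable M ∧
      PartLearns M {L : Set ℕ | ∃ e, Wset e = L} ∧
      FinApproxLearns M {L : Set ℕ | ∃ e, Wset e = L} := by
  classical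
  obtain ⟨h, hprim, hinj, hW⟩ := exists_patch
  have hmem (e k : ℕ) (σ : List (Option ℕ)) (y : ℕ) : y ∈ Wset (h e (contentTable k σ)) ↔
      if y < k then some y ∈ σ else y ∈ Wset e := by
    rw [hW, getElem?_contentTable]
    split_ifs <;> simp
  refine ⟨fun σ => h (pick σ) (contentTable (lastBelow (pick σ) σ) σ), ?_, ?_, ?_⟩
  · have hk : Primrec fun σ => lastBelow (pick σ) σ :=
      primrec_lastBelow.comp primrec_pick Primrec.id
    exact (hprim.comp primrec_pick (primrec_contentTable.comp hk Primrec.id)).to_comp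
  · intro L hL T hT
    obtain ⟨e, heL, hfreq, hlow⟩ := exists_pick_limit hT hL
    obtain ⟨K, hK⟩ := exists_lastBelow_eq hlow
    have hconst : ∀ᶠ n in atTop, pick (pref T n) = e →
        h (pick (pref T n)) (contentTable (lastBelow (pick (pref T n)) (pref T n)) (pref T n))
          = h e ((List.range K).map fun y => decide (y ∈ L)) := by
      filter_upwards [hK, eventually_forall_lt (eventually_mem_pref_iff hT) K] with n h₁ h₂ h₃
      rw [h₃, h₁, contentTable]
      congr 1
      refine List.map_congr_left fun y hy => ?_
      simp only [h₂ y (List.mem_range.1 hy)]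
    refine ⟨h e ((List.range K).map fun y => decide (y ∈ L)), ?_, ?_, ?_⟩
    · exact Nat.frequently_atTop_iff_infinite.1
        ((hfreq.and_eventually hconst).mono fun n hn => hn.2 hn.1)
    · ext y
      rw [hW, heL]
      by_cases hy : y < K <;> simp [hy]
    · intro d hd
      by_contra hne
      have hd' := Nat.frequently_atTop_iff_infinite.2 hd
      obtain ⟨m, hm⟩ := hd'.exists
      obtain ⟨n, hn, hc, hl, hlast⟩ := (hd'.and_eventually (hconst.and (hlow.and
        (eventually_le_lastBelow hfreq (lastBelow (pick (pref T m)) (pref T m) + 1))))).exists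
      have hlt : e < pick (pref T n) :=
        lt_of_le_of_ne hl fun heq => hne (hn.symm.trans (hc heq.symm))
      have hlen := congrArg List.length (hinj _ _ _ _ (hm.trans hn.symm))
      simp only [contentTable, List.length_map, List.length_range] at hlen
      have := hlast _ hlt
      omega
  · intro L hL T hT D
    obtain ⟨e, heL, hfreq, hlow⟩ := exists_pick_limit hT hL
    filter_upwards [hlow, eventually_le_lastBelow hfreq (D.sup id + 1),
      eventually_forall_lt (eventually_mem_pref_iff hT) (D.sup id + 1)] with n h₁ h₂ h₃
    ext y
    refine and_congr_left fun hy => ?_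
    have hyD : y < D.sup id + 1 := Nat.lt_succ_of_le (Finset.le_sup (f := id) hy)
    rw [hmem]
    split_ifs with hlt
    · exact h₃ y hyD
    · rcases h₁.eq_or_lt with heq | hgt
      · rw [← heq, heL]
      · exact absurd (hyD.trans_le (h₂ _ hgt)) hlt
end

section
/- There is a single learner M which is consistent (Cons) and weakly approximately (WeakApprox) learns the class of all infinite r.e. subsets of ℕ. -/
open Filter

/-- Uniformly r.e. families of sets have a computable indexing function. -/
theorem exists_computable_index {α : Type*} [Primcodable α] {R : α → ℕ → Prop}
    (hR : REPred fun p : α × ℕ => R p.1 p.2) :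
    ∃ M : α → ℕ, Computable M ∧ ∀ a, Wset (M a) = {x | R a x} := by
  obtain ⟨c, hc⟩ := Nat.Partrec.Code.exists_code.1 hR
  refine ⟨fun a => Encodable.encode (c.curry (Encodable.encode a)), ?_, fun a => ?_⟩
  · exact (Primrec.encode.comp
      (Nat.Partrec.Code.primrec₂_curry.comp (Primrec.const c) Primrec.encode)).to_comp
  · ext x
    have hx : Nat.pair (Encodable.encode a) x = Encodable.encode (a, x) := by simp
    simp only [Wset, phi, Denumerable.ofNat_encode, PFun.mem_dom, Nat.Partrec.Code.eval_curry, hc,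
      hx, Encodable.encodek]
    simp

/-- The set conjectured on `σ`: the numbers occurring in `σ` together with all numbers
above them. -/
def recordHypothesis (σ : List (Option ℕ)) : Set ℕ :=
  {x | (∃ o ∈ σ, o = some x) ∨ ∀ o ∈ σ, o.getD 0 ≤ x}

theorem primrecPred_recordHypothesis :
    PrimrecPred fun p : List (Option ℕ) × ℕ => p.2 ∈ recordHypothesis p.1 := by
  have heq : PrimrecRel fun (o : Option ℕ) (x : ℕ) => o = some x :=
    Primrec.eq.comp Primrec.fst (Primrec.option_some.comp Primrec.snd)
  have hle : PrimrecRel fun (o : Option ℕ) (x : ℕ) => o.getD 0 ≤ x :=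
    Primrec.nat_le.comp (Primrec.option_getD.comp Primrec.fst (Primrec.const 0)) Primrec.snd
  exact PrimrecPred.or heq.exists_mem_list hle.forall_mem_list

/-- The elements of a text that are at least as large as everything preceding them. -/
def records (T : ℕ → Option ℕ) : Set ℕ :=
  {x | ∃ n, T n = some x ∧ ∀ m < n, (T m).getD 0 ≤ x}

theorem records_infinite {T : ℕ → Option ℕ} {L : Set ℕ} (hT : IsText T L) (hL : L.Infinite) :
    (records T).Infinite := by
  refine Set.infinite_of_forall_exists_gt fun N => ?_
  have hex : ∃ n, N < (T n).getD 0 := by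
    obtain ⟨x, hxL, hx⟩ := hL.exists_gt N
    rw [← hT] at hxL
    obtain ⟨n, hn⟩ := hxL
    exact ⟨n, by simpa [hn] using hx⟩
  classical
  have hspec := Nat.find_spec hex
  cases hn : T (Nat.find hex) with
  | none => simp [hn] at hspec
  | some x =>
    have hx : N < x := by simpa [hn] using hspec
    exact ⟨x, ⟨_, hn, fun m hm => (not_lt.1 (Nat.find_min hex hm)).trans hx.le⟩, hx⟩

theorem mem_recordHypothesis_pref {T : ℕ → Option ℕ} {n x : ℕ} :
    x ∈ recordHypothesis (pref T n) ↔
      (∃ m < n, T m = some x) ∨ ∀ m < n, (T m).getD 0 ≤ x := by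
  simp [recordHypothesis, pref]

theorem records_subset_recordHypothesis (T : ℕ → Option ℕ) (n : ℕ) :
    records T ⊆ recordHypothesis (pref T n) := by
  rintro x ⟨k, hk, hmax⟩
  rw [mem_recordHypothesis_pref]
  rcases lt_or_ge k n with hkn | hnk
  · exact .inl ⟨k, hkn, hk⟩
  · exact .inr fun m hm => hmax m (hm.trans_le hnk)

theorem eventually_mem_recordHypothesis_iff {T : ℕ → Option ℕ} {L : Set ℕ} (hT : IsText T L)
    (hL : L.Infinite) (x : ℕ) :
    ∀ᶠ n in atTop, x ∈ recordHypothesis (pref T n) ↔ x ∈ L := by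
  obtain ⟨y, hyL, hy⟩ := hL.exists_gt x
  rw [← hT] at hyL
  obtain ⟨k, hk⟩ := hyL
  have hexcl : ∀ᶠ n in atTop, ¬ ∀ m < n, (T m).getD 0 ≤ x := by
    filter_upwards [eventually_gt_atTop k] with n hn h
    have := h k hn
    simp only [hk, Option.getD_some] at this
    omega
  by_cases hx : ∃ j, T j = some x
  · obtain ⟨j, hj⟩ := hx
    filter_upwards [eventually_gt_atTop j] with n hn
    rw [mem_recordHypothesis_pref, ← hT]
    exact iff_of_true (.inl ⟨j, hn, hj⟩) ⟨j, hj⟩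
  · filter_upwards [hexcl] with n hn
    rw [mem_recordHypothesis_pref, ← hT]
    exact iff_of_false (by rintro (⟨m, -, hm⟩ | h); exacts [hx ⟨m, hm⟩, hn h]) hx

/-- There is a single consistent learner which weakly approximately learns the
class of all infinite r.e. subsets of ℕ. -/
theorem stmt4 :
    ∃ M : List (Option ℕ) → ℕ, Computable M ∧ ConsLearner M ∧
      WeakApproxLearns M {L : Set ℕ | L.Infinite ∧ ∃ e, Wset e = L} := by
  obtain ⟨M, hM, hW⟩ := exists_computable_index
    (R := fun σ x => x ∈ recordHypothesis σ) primrecPred_recordHypothesis.computablePred.to_re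
  replace hW : ∀ σ, Wset (M σ) = recordHypothesis σ := hW
  refine ⟨M, hM, fun σ x hx => hW σ ▸ .inl ⟨_, hx, rfl⟩, ?_⟩
  rintro L ⟨hL, -⟩ T hT
  refine ⟨records T, records_infinite hT hL, fun V hV => ?_⟩
  filter_upwards [hV.eventually_all.2 fun x _ => eventually_mem_recordHypothesis_iff hT hL x]
    with n hn
  ext x
  rw [hW, Set.mem_inter_iff, Set.mem_inter_iff, and_congr_left_iff]
  intro hxV
  by_cases hx : x ∈ records T
  · obtain ⟨k, hk, -⟩ := id hx
    exact iff_of_true (records_subset_recordHypothesis T n hx) (hT ▸ ⟨k, hk⟩)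
  · exact hn x (.inl ⟨hxV, hx⟩)
end

section
/- Let C be the class of all cofinite subsets of ℕ. Then: (1) there is a single learner which simultaneously is consistent (Cons), weakly approximately (WeakApprox) learns C, BC*-learns C and partially (Part) learns C; (2) no learner approximately (Approx) learns C; and (3) for every n ∈ ℕ, no learner BC^n-learns C. -/
open Filter

/-! ### Prefixes of texts and locking sequences -/

theorem pref_succ (T : ℕ → Option ℕ) (n : ℕ) : pref T (n + 1) = pref T n ++ [T n] := by
  simp [pref, List.range_succ]

theorem mem_pref {T : ℕ → Option ℕ} {n : ℕ} {o : Option ℕ} :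
    o ∈ pref T n ↔ ∃ i < n, T i = o := by
  simp [pref]

/-- Any finite sequence over `L` extends to a text for `L`. -/
theorem exists_text_extending {L : Set ℕ} {σ : List (Option ℕ)} (hσ : ∀ x, some x ∈ σ → x ∈ L) :
    ∃ T, IsText T L ∧ ∀ n ≥ σ.length, σ <+: pref T n := by
  classical
  let T : ℕ → Option ℕ := fun n =>
    if h : n < σ.length then σ[n] else if n - σ.length ∈ L then some (n - σ.length) else none
  have hT : pref T σ.length = σ := by
    refine List.ext_getElem (by simp [pref]) fun i h₁ h₂ => ?_
    simp [pref, T, h₂]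
  refine ⟨T, ?_, fun n hn => ?_⟩
  · ext x
    constructor
    · rintro ⟨n, hn⟩
      by_cases h : n < σ.length
      · exact hσ x (by simp only [T, h, dite_true] at hn; exact hn ▸ List.getElem_mem h)
      · by_cases h' : n - σ.length ∈ L
        · simp only [T, h, h', dite_false, if_true, Option.some.injEq] at hn
          exact hn ▸ h'
        · simp [T, h, h'] at hn
    · intro hx
      exact ⟨σ.length + x, by simp [T, hx]⟩
  · induction n, hn using Nat.le_induction with
    | base => rw [hT]
    | succ n _ ih => rw [pref_succ]; exact ih.trans (List.prefix_append _ _)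

/-- A property holding eventually along every text for `ℕ` has a locking sequence. -/
theorem exists_locking_sequence {P : List (Option ℕ) → Prop}
    (hP : ∀ T, IsText T Set.univ → ∀ᶠ n in atTop, P (pref T n)) :
    ∃ σ, ∀ τ, σ <+: τ → P τ := by
  by_contra! hcon
  choose g hg hgP using hcon
  obtain ⟨s, hs, hsP⟩ : ∃ s : ℕ → List (Option ℕ),
      (∀ i, s i ++ [some i] <+: s (i + 1)) ∧ ∀ i, ¬ P (s (i + 1)) :=
    ⟨fun i => Nat.rec [] (fun i σ => g (σ ++ [some i])) i, fun _ => hg _, fun _ => hgP _⟩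
  have hs' : ∀ i, s i <+: s (i + 1) := fun i => (List.prefix_append _ _).trans (hs i)
  have hmono : ∀ i j, i ≤ j → s i <+: s j := fun i j hij => by
    induction j, hij using Nat.le_induction with
    | base => exact List.prefix_rfl
    | succ j _ ih => exact ih.trans (hs' j)
  have hlen : ∀ i, i ≤ (s i).length := fun i => by
    induction i with
    | zero => simp
    | succ i ih => have := (hs i).length_le; simp at this; omega
  let T : ℕ → Option ℕ := fun n => (s (n + 1))[n]'(hlen (n + 1))
  have hT : ∀ i n (h : n < (s i).length), T n = (s i)[n] := fun i n h => by
    rcases le_total i (n + 1) with hi | hi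
    · exact ((hmono _ _ hi).getElem h).symm
    · exact (hmono _ _ hi).getElem _
  have hpref : ∀ i, pref T (s i).length = s i := fun i => by
    refine List.ext_getElem (by simp [pref]) fun n h₁ h₂ => ?_
    simp [pref, hT i n h₂]
  have hText : IsText T Set.univ := by
    refine Set.eq_univ_of_forall fun x => ?_
    have hx : some x ∈ pref T (s (x + 1)).length := by
      rw [hpref]; exact (hs x).subset (by simp)
    obtain ⟨n, -, hn⟩ := mem_pref.1 hx
    exact ⟨n, hn⟩
  obtain ⟨N, hN⟩ := eventually_atTop.1 (hP T hText)
  have := hN (s (N + 1)).length ((Nat.le_succ N).trans (hlen _))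
  rw [hpref] at this
  exact hsP _ this

theorem exists_pref_bound (σ : List (Option ℕ)) : ∃ b, ∀ x, some x ∈ σ → x < b := by
  refine ⟨σ.reduceOption.sum + 1, fun x hx => ?_⟩
  exact Nat.lt_succ_of_le (List.le_sum_of_mem (List.reduceOption_mem_iff.2 hx))

theorem not_approxLearns_cofinite (M : List (Option ℕ) → ℕ) :
    ¬ ApproxLearns M {L : Set ℕ | Lᶜ.Finite} := by
  intro hM
  obtain ⟨W, hW, hWT⟩ := hM Set.univ (by simp)
  obtain ⟨σ, hσ⟩ := exists_locking_sequence (P := fun σ => W ⊆ Wset (M σ)) fun T hT =>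
    (hWT T hT W (by simp)).mono fun n hn => by simpa using hn
  obtain ⟨b, hb⟩ := exists_pref_bound σ
  obtain ⟨w, hwW, hwb⟩ := hW.exists_gt b
  obtain ⟨W', -, hW'⟩ := hM {w}ᶜ (by simp)
  obtain ⟨T, hT, hpre⟩ := exists_text_extending (L := {w}ᶜ) (σ := σ) fun x hx hxw => by
    have := hb x hx
    rw [Set.mem_singleton_iff] at hxw
    omega
  have hfin : (symmDiff (insert w W') W').Finite :=
    (Set.finite_singleton w).subset fun x hx => by
      rcases hx with ⟨h | h, h'⟩ | ⟨h, h'⟩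
      · exact h
      · exact absurd h h'
      · exact absurd (Or.inr h) h'
  obtain ⟨n, hn, hn'⟩ := ((hW' T hT _ hfin).and (eventually_ge_atTop σ.length)).exists
  have hw : w ∈ Wset (M (pref T n)) ∩ insert w W' := ⟨hσ _ (hpre n hn') hwW, by simp⟩
  rw [hn] at hw
  exact hw.1 rfl

theorem not_bcnLearns_cofinite (k : ℕ) (M : List (Option ℕ) → ℕ) :
    ¬ BCnLearns k M {L : Set ℕ | Lᶜ.Finite} := by
  intro hM
  obtain ⟨σ, hσ⟩ := exists_locking_sequence (P := fun σ => (symmDiff (Wset (M σ)) Set.univ).Finite ∧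
    (symmDiff (Wset (M σ)) Set.univ).ncard ≤ k) fun T hT => hM Set.univ (by simp) T hT
  obtain ⟨b, hb⟩ := exists_pref_bound σ
  let F : Finset ℕ := Finset.Ico b (b + (2 * k + 1))
  obtain ⟨T, hT, hpre⟩ := exists_text_extending (L := (↑F)ᶜ) (σ := σ) fun x hx hxF => by
    have := hb x hx
    have := (Finset.mem_Ico.1 (Finset.mem_coe.1 hxF)).1
    omega
  obtain ⟨n, ⟨hfin, hcard⟩, hn⟩ :=
    ((hM (↑F)ᶜ (by simp) T hT).and (eventually_ge_atTop σ.length)).exists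
  obtain ⟨hfin', hcard'⟩ := hσ _ (hpre n hn)
  have hsub : (F : Set ℕ) ⊆ symmDiff (Wset (M (pref T n))) Set.univ ∪
      symmDiff (Wset (M (pref T n))) (↑F)ᶜ := fun x hx => by
    by_cases h : x ∈ Wset (M (pref T n))
    · exact Or.inr (Or.inl ⟨h, fun h' => h' hx⟩)
    · exact Or.inl (Or.inr ⟨trivial, h⟩)
  have h₁ := Set.ncard_le_ncard hsub (hfin'.union hfin)
  have h₂ := Set.ncard_union_le (symmDiff (Wset (M (pref T n))) Set.univ)
    (symmDiff (Wset (M (pref T n))) (↑F)ᶜ)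
  have h₃ : (F : Set ℕ).ncard = 2 * k + 1 := by simp [F]
  omega

/-! ### One-by-one enumerations -/

/-- `S` enumerates `L` one element at a time, the most recent element first. -/
structure Enumerates (S : ℕ → List ℕ) (L : Set ℕ) : Prop where
  zero : S 0 = []
  step : ∀ n, S (n + 1) = S n ∨ ∃ x ∉ S n, S (n + 1) = x :: S n
  mem_iff : ∀ x, x ∈ L ↔ ∃ n, x ∈ S n

/-- The numbers below the most recent element of `l` which do not occur in `l`. -/
def missing (l : List ℕ) : List ℕ := (List.range (l.headD 0)).filter (· ∉ l)

theorem mem_missing {l : List ℕ} {x : ℕ} : x ∈ missing l ↔ x < l.headD 0 ∧ x ∉ l := by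
  simp [missing]

theorem missing_ext {l l' : List ℕ} (h : ∀ x, x ∈ missing l ↔ x ∈ missing l') :
    missing l = missing l' := by
  have hs : ∀ l, (missing l).Pairwise (· < ·) := fun l => List.pairwise_lt_range.filter _
  refine List.Perm.eq_of_pairwise (fun a b _ _ h₁ h₂ => absurd h₁ h₂.asymm) (hs l) (hs l') ?_
  exact (List.perm_ext_iff_of_nodup ((hs l).imp ne_of_lt) ((hs l').imp ne_of_lt)).2 h

theorem exists_mem_notMem_list {L : Set ℕ} (hL : L.Infinite) (l : List ℕ) :
    ∃ x ∈ L, x ∉ l := by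
  by_contra! h
  exact hL ((List.finite_toSet l).subset h)

namespace Enumerates

variable {S : ℕ → List ℕ} {L : Set ℕ}

theorem mono (hS : Enumerates S L) {m n : ℕ} (h : m ≤ n) : S m ⊆ S n := by
  induction n, h using Nat.le_induction with
  | base => exact List.Subset.refl _
  | succ n _ ih =>
    rcases hS.step n with h | ⟨x, -, h⟩ <;> rw [h]
    · exact ih
    · exact List.subset_cons_of_subset _ ih

theorem eventually_mem (hS : Enumerates S L) {x : ℕ} (hx : x ∈ L) : ∀ᶠ n in atTop, x ∈ S n := by
  obtain ⟨n, hn⟩ := (hS.mem_iff x).1 hx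
  exact eventually_atTop.2 ⟨n, fun m hm => hS.mono hm hn⟩

theorem exists_least_stage (hS : Enumerates S L) {p : ℕ → Prop} (hp : ∃ x ∈ L, p x) :
    ∃ n x, p x ∧ S (n + 1) = x :: S n ∧ ∀ y ∈ S n, ¬ p y := by
  classical
  have hex : ∃ n, ∃ x ∈ S n, p x := by
    obtain ⟨x, hx, hpx⟩ := hp
    obtain ⟨n, hn⟩ := (hS.mem_iff x).1 hx
    exact ⟨n, x, hn, hpx⟩
  obtain ⟨z, hz, hpz⟩ := Nat.find_spec hex
  cases hn : Nat.find hex with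
  | zero => simp [hn, hS.zero] at hz
  | succ n =>
    have hmin : ∀ y ∈ S n, ¬ p y := fun y hy hpy =>
      Nat.find_min hex (m := n) (by omega) ⟨y, hy, hpy⟩
    rw [hn] at hz
    rcases hS.step n with h | ⟨x, -, h⟩
    · exact absurd hpz (hmin z (h ▸ hz))
    · rw [h, List.mem_cons] at hz
      rcases hz with rfl | hz
      · exact ⟨n, z, hpz, h, hmin⟩
      · exact absurd hpz (hmin z hz)

theorem eventually_lt_head (hS : Enumerates S L) (hL : L.Infinite) (b : ℕ) :
    ∀ᶠ n in atTop, b < (S n).headD 0 := by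
  have hall : ∀ᶠ n in atTop, ∀ x ∈ L ∩ Set.Iic b, x ∈ S n :=
    ((Set.finite_Iic b).subset Set.inter_subset_right).eventually_all.2
      fun x hx => hS.eventually_mem hx.1
  obtain ⟨N, hN⟩ := hall.exists
  have key : ∀ n ≥ N, S n = S N ∨ b < (S n).headD 0 := fun n hn => by
    induction n, hn using Nat.le_induction with
    | base => exact Or.inl rfl
    | succ n hn ih =>
      rcases hS.step n with h | ⟨x, hx, h⟩
      · rwa [h]
      · right
        have hxL : x ∈ L := (hS.mem_iff x).2 ⟨n + 1, by simp [h]⟩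
        by_contra! hle
        rw [h, List.headD_cons] at hle
        exact hx (hS.mono hn (hN x ⟨hxL, hle⟩))
  obtain ⟨z, hz, hzN⟩ := exists_mem_notMem_list hL (S N)
  filter_upwards [hS.eventually_mem hz, eventually_ge_atTop N] with n hzn hn
  exact (key n hn).resolve_left fun h => hzN (h ▸ hzn)

theorem eventually_notMem_missing_iff (hS : Enumerates S L) (hL : L.Infinite) (x : ℕ) :
    ∀ᶠ n in atTop, (x ∉ missing (S n) ↔ x ∈ L) := by
  by_cases hx : x ∈ L
  · filter_upwards [hS.eventually_mem hx] with n hn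
    simp [mem_missing, hn, hx]
  · filter_upwards [hS.eventually_lt_head hL x] with n hn
    have : x ∉ S n := fun h => hx ((hS.mem_iff x).2 ⟨n, h⟩)
    simp only [mem_missing, hn, this, hx]
    simp

/-- Infinitely many elements of `L` are enumerated before every larger element of `L`; these
are never missing. -/
theorem infinite_never_missing (hS : Enumerates S L) (hL : L.Infinite) :
    {w | w ∈ L ∧ ∀ n, w ∉ missing (S n)}.Infinite := by
  refine Set.infinite_of_forall_exists_gt fun m => ?_
  obtain ⟨n, w, hw, hSn, hmin⟩ := hS.exists_least_stage (hL.exists_gt m)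
  refine ⟨w, ⟨(hS.mem_iff w).2 ⟨n + 1, by simp [hSn]⟩, fun k hk => ?_⟩, hw⟩
  obtain ⟨hlt, hnot⟩ := mem_missing.1 hk
  rcases le_or_gt k n with hkn | hkn
  · cases hc : S k with
    | nil => simp [hc] at hlt
    | cons z l =>
      have hz := hmin z (hS.mono hkn (by simp [hc]))
      rw [hc, List.headD_cons] at hlt
      omega
  · exact hnot (hS.mono hkn (by simp [hSn]))

/-- Infinitely often exactly the complement of `L` is missing. -/
theorem frequently_mem_missing_iff (hS : Enumerates S L) (hL : Lᶜ.Finite) :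
    ∃ᶠ n in atTop, ∀ x, x ∈ missing (S n) ↔ x ∉ L := by
  have hLi : L.Infinite := by simpa using hL.infinite_compl
  obtain ⟨b, hb⟩ := hL.bddAbove
  obtain ⟨N₀, hN₀⟩ := eventually_atTop.1 (hS.eventually_lt_head hLi b)
  refine frequently_atTop.2 fun N₁ => ?_
  let N := max N₀ N₁
  classical
  have hex := exists_mem_notMem_list hLi (S N)
  let x := Nat.find hex
  have hx : x ∈ L ∧ x ∉ S N := Nat.find_spec hex
  obtain ⟨n, _, rfl, hSn, -⟩ := hS.exists_least_stage (p := (· = x)) ⟨x, hx.1, rfl⟩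
  have hn : N ≤ n + 1 := by
    by_contra! h
    exact hx.2 (hS.mono h.le (by simp [hSn]))
  refine ⟨n + 1, (le_max_right _ _).trans hn, fun y => ?_⟩
  rw [mem_missing]
  constructor
  · rintro ⟨hlt, hnot⟩ hy
    rw [hSn, List.headD_cons] at hlt
    have := Nat.find_min hex hlt
    exact hnot (hS.mono hn (by_contra fun h => this ⟨hy, h⟩))
  · intro hy
    exact ⟨(hb hy).trans_lt (hN₀ _ ((le_max_left _ _).trans hn)),
      fun h => hy ((hS.mem_iff y).2 ⟨_, h⟩)⟩

end Enumerates

/-! ### The learner -/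

/-- The distinct numbers occurring in `σ`, the one with the latest first occurrence first. -/
def seen (σ : List (Option ℕ)) : List ℕ :=
  σ.foldl (fun l o => o.elim l fun x => if x ∈ l then l else x :: l) []

theorem seen_concat (σ : List (Option ℕ)) (o : Option ℕ) :
    seen (σ ++ [o]) = o.elim (seen σ) fun x => if x ∈ seen σ then seen σ else x :: seen σ := by
  rw [seen, List.foldl_append]
  rfl

theorem mem_seen {σ : List (Option ℕ)} {x : ℕ} : x ∈ seen σ ↔ some x ∈ σ := by
  induction σ using List.reverseRecOn with
  | nil => simp [seen]
  | append_singleton σ o ih =>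
    rw [seen_concat]
    cases o with
    | none => simp [ih]
    | some y =>
      rw [List.mem_append, ← ih]
      by_cases h : y ∈ seen σ
      · simp only [Option.elim, h, if_true, List.mem_singleton, Option.some.injEq]
        exact ⟨Or.inl, fun h' => h'.elim id fun h'' => h'' ▸ h⟩
      · simp [h, or_comm]

theorem enumerates_seen_pref {T : ℕ → Option ℕ} {L : Set ℕ} (hT : IsText T L) :
    Enumerates (fun n => seen (pref T n)) L where
  zero := rfl
  step n := by
    rw [pref_succ, seen_concat]
    cases T n with
    | none => exact Or.inl rfl
    | some x =>
      by_cases h : x ∈ seen (pref T n)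
      · exact Or.inl (by simp [h])
      · exact Or.inr ⟨x, h, by simp [h]⟩
  mem_iff x := by
    simp only [mem_seen, mem_pref]
    rw [← hT]
    exact ⟨fun ⟨n, hn⟩ => ⟨n + 1, n, n.lt_succ_self, hn⟩, fun ⟨_, i, _, hi⟩ => ⟨i, hi⟩⟩

theorem primrecRel_list_mem : PrimrecRel fun (x : ℕ) (l : List ℕ) => x ∈ l :=
  ((Primrec.eq (α := ℕ)).exists_mem_list.comp Primrec.snd Primrec.fst).of_eq (by simp)

theorem primrec_seen : Primrec seen := by
  refine Primrec.list_foldl (f := fun σ : List (Option ℕ) => σ)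
    (h := fun _ (p : List ℕ × Option ℕ) =>
      p.2.elim p.1 fun x => if x ∈ p.1 then p.1 else x :: p.1)
    Primrec.id (Primrec.const []) ?_
  have h : Primrec₂ fun (p : List (Option ℕ) × List ℕ × Option ℕ) (x : ℕ) =>
      if x ∈ p.2.1 then p.2.1 else x :: p.2.1 := by
    have hl : Primrec fun q : (List (Option ℕ) × List ℕ × Option ℕ) × ℕ => q.1.2.1 :=
      Primrec.fst.comp (Primrec.snd.comp Primrec.fst)
    exact Primrec.ite (primrecRel_list_mem.comp Primrec.snd hl) hl
      (Primrec.list_cons.comp Primrec.snd hl)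
  refine (Primrec.option_casesOn (Primrec.snd.comp Primrec.snd)
    (Primrec.fst.comp Primrec.snd) h).of_eq fun p => ?_
  rcases p with ⟨_, _, _ | _⟩ <;> rfl

theorem primrec_missing : Primrec missing := by
  have hhead : Primrec fun l : List ℕ => l.headD 0 :=
    (Primrec.option_getD.comp Primrec.list_head? (Primrec.const 0)).of_eq fun l => by
      cases l <;> rfl
  have h : PrimrecRel fun (x : ℕ) (l : List ℕ) => x ∉ l := primrecRel_list_mem.not
  exact (h.listFilter.comp (Primrec.list_range.comp hhead) Primrec.id).of_eq fun _ => rfl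

/-- Uniformly computable indices for the complements of finite lists. -/
theorem exists_computable_index_compl :
    ∃ f : List ℕ → ℕ, Computable f ∧ ∀ D, Wset (f D) = {x | x ∉ D} := by
  have hre : REPred fun p : List ℕ × ℕ => p.2 ∉ p.1 :=
    (primrecRel_list_mem.comp Primrec.snd Primrec.fst).not.computablePred.to_re
  obtain ⟨c, hc⟩ := Nat.Partrec.Code.exists_code.1 hre
  refine ⟨fun D => Encodable.encode (c.curry (Encodable.encode D)), ?_, fun D => ?_⟩
  · exact Computable.encode.comp (Nat.Partrec.Code.primrec₂_curry.to_comp.comp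
      (Computable.const c) Computable.encode)
  · ext x
    have hdec : (Encodable.decode (Nat.pair (Encodable.encode D) x) : Option (List ℕ × ℕ)) =
        some (D, x) := Encodable.encodek (D, x)
    simp only [Wset, phi, Denumerable.ofNat_encode, PFun.mem_dom, Nat.Partrec.Code.eval_curry, hc,
      hdec]
    simp

theorem exists_learner_cofinite :
    ∃ M : List (Option ℕ) → ℕ, Computable M ∧ ConsLearner M ∧
       WeakApproxLearns M {L : Set ℕ | Lᶜ.Finite} ∧
       BCstarLearns M {L : Set ℕ | Lᶜ.Finite} ∧
       PartLearns M {L : Set ℕ | Lᶜ.Finite} := by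
  obtain ⟨f, hf, hfW⟩ := exists_computable_index_compl
  have hmem : ∀ σ x, x ∈ Wset (f (missing (seen σ))) ↔ x ∉ missing (seen σ) := fun σ x => by
    rw [hfW]; rfl
  have hinf : ∀ {L : Set ℕ}, Lᶜ.Finite → L.Infinite := fun hL => by
    simpa using hL.infinite_compl
  refine ⟨fun σ => f (missing (seen σ)), hf.comp (primrec_missing.comp primrec_seen).to_comp,
    fun σ x hx => ?_, fun L hL T hT => ?_, fun L hL T hT => ?_, fun L hL T hT => ?_⟩
  · rw [hmem, mem_missing]
    exact fun h => h.2 (mem_seen.2 hx)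
  · have hS := enumerates_seen_pref hT
    refine ⟨_, hS.infinite_never_missing (hinf hL), fun V hV => ?_⟩
    filter_upwards [hV.eventually_all.2
      fun x _ => hS.eventually_notMem_missing_iff (hinf hL) x] with n hn
    ext x
    refine and_congr_left fun hxV => ?_
    rw [hmem]
    by_cases hxW : x ∈ {w | w ∈ L ∧ ∀ n, w ∉ missing (seen (pref T n))}
    · exact iff_of_true (hxW.2 n) hxW.1
    · exact hn x (Or.inl ⟨hxV, hxW⟩)
  · refine Eventually.of_forall fun n => ?_
    refine ((List.finite_toSet (missing (seen (pref T n)))).union hL).subset fun x hx => ?_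
    rcases hx with ⟨-, h⟩ | ⟨-, h⟩
    · exact Or.inr h
    · exact Or.inl (by_contra fun h' => h ((hmem _ _).2 h'))
  · have hS := enumerates_seen_pref hT
    have hfreq := hS.frequently_mem_missing_iff hL
    obtain ⟨m, hm⟩ := hfreq.exists
    refine ⟨f (missing (seen (pref T m))), ?_, ?_, fun d hd => ?_⟩
    · refine Nat.frequently_atTop_iff_infinite.1 (hfreq.mono fun n hn => ?_)
      exact congrArg f (missing_ext fun x => (hn x).trans (hm x).symm)
    · ext x
      rw [hmem, hm, not_not]
    · have hd' := Nat.frequently_atTop_iff_infinite.2 hd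
      have hdL : ∀ x, x ∈ Wset d ↔ x ∈ L := fun x => by
        obtain ⟨n, hn, hx⟩ :=
          (hd'.and_eventually (hS.eventually_notMem_missing_iff (hinf hL) x)).exists
        rw [← hx, ← hmem]
        exact hn ▸ Iff.rfl
      obtain ⟨n, rfl⟩ := hd'.exists
      refine congrArg f (missing_ext fun x => ?_)
      rw [hm, ← hdL, hmem, not_not]

/-- The class of all cofinite sets is ConsWeakApproxBC*Part learnable, but
neither Approx learnable nor BC^n learnable for any n. -/
theorem stmt6 :
    (∃ M : List (Option ℕ) → ℕ, Computable M ∧ ConsLearner M ∧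
       WeakApproxLearns M {L : Set ℕ | Lᶜ.Finite} ∧
       BCstarLearns M {L : Set ℕ | Lᶜ.Finite} ∧
       PartLearns M {L : Set ℕ | Lᶜ.Finite}) ∧
    (¬ ∃ M : List (Option ℕ) → ℕ, Computable M ∧
       ApproxLearns M {L : Set ℕ | Lᶜ.Finite}) ∧
    (∀ k : ℕ, ¬ ∃ M : List (Option ℕ) → ℕ, Computable M ∧
       BCnLearns k M {L : Set ℕ | Lᶜ.Finite}) := by
  exact ⟨exists_learner_cofinite, fun ⟨M, _, hM⟩ => not_approxLearns_cofinite M hM,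
    fun k ⟨M, _, hM⟩ => not_bcnLearns_cofinite k M hM⟩
end

section
/- If a class C of r.e. sets is consistently partially (ConsPart) learnable, then there is a single prudent learner which simultaneously finitely approximately (FinApprox) learns C, is consistent (Cons), and partially (Part) learns C. -/
open Filter

namespace PartialLearning

/-! ### Bounded search and list membership -/

/-- The least `k < n` with `p k = true`, if any. -/
def boundedFind (p : ℕ → Bool) (n : ℕ) : Option ℕ :=
  Nat.rec none (fun k r => Option.casesOn r (bif p k then some k else none) some) n

theorem boundedFind_eq_none {p : ℕ → Bool} {n : ℕ} :
    boundedFind p n = none ↔ ∀ k < n, p k = false := by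
  induction n with
  | zero => simp [boundedFind]
  | succ n ih =>
    have hs : boundedFind p (n + 1) = Option.casesOn (boundedFind p n)
        (bif p n then some n else none) some := rfl
    rw [hs]
    cases hr : boundedFind p n with
    | none =>
      have hn := ih.1 hr
      cases hp : p n
      · simp only [cond_false, true_iff]
        intro k hk
        rcases Nat.lt_succ_iff_lt_or_eq.1 hk with h | rfl
        · exact hn k h
        · exact hp
      · simp only [cond_true, reduceCtorEq, false_iff]
        intro h
        simp [h n (Nat.lt_succ_self n)] at hp
    | some k =>
      simp only [reduceCtorEq, false_iff]
      intro h
      have := ih.2 fun j hj => h j (hj.trans (Nat.lt_succ_self n))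
      simp [hr] at this

theorem boundedFind_eq_some {p : ℕ → Bool} {n k : ℕ} (h : boundedFind p n = some k) :
    k < n ∧ p k = true ∧ ∀ j < k, p j = false := by
  induction n with
  | zero => simp [boundedFind] at h
  | succ n ih =>
    have hs : boundedFind p (n + 1) = Option.casesOn (boundedFind p n)
        (bif p n then some n else none) some := rfl
    rw [hs] at h
    cases hr : boundedFind p n with
    | none =>
      rw [hr] at h
      cases hp : p n
      · simp [hp] at h
      · simp only [hp, cond_true, Option.some.injEq] at h
        subst h
        exact ⟨Nat.lt_succ_self _, hp, boundedFind_eq_none.1 hr⟩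
    | some m =>
      rw [hr] at h
      obtain ⟨h1, h2⟩ := ih (hr.trans h)
      exact ⟨h1.trans (Nat.lt_succ_self n), h2⟩

theorem computable_boundedFind {α : Type*} [Primcodable α] {p : α → ℕ → Bool} {n : α → ℕ}
    (hp : Computable₂ p) (hn : Computable n) : Computable fun a => boundedFind (p a) (n a) := by
  unfold boundedFind
  refine Computable.nat_rec (h := fun a q => Option.casesOn q.2
    (bif p a q.1 then some q.1 else none) some) hn (Computable.const none) ?_
  refine Computable.option_casesOn (Computable.snd.comp Computable.snd) ?_
    (Computable.option_some.comp Computable.snd).to₂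
  have h1 : Computable fun q : α × ℕ × Option ℕ => q.2.1 := Computable.fst.comp Computable.snd
  exact Computable.cond (hp.comp Computable.fst h1) (Computable.option_some.comp h1)
    (Computable.const none)

theorem primrec_mem_list : Primrec₂ fun (l : List ℕ) (x : ℕ) => decide (x ∈ l) := by
  have h : PrimrecRel fun (l : List ℕ) (x : ℕ) => ∃ a ∈ l, a = x :=
    PrimrecRel.exists_mem_list Primrec.eq
  exact (h.decide).of_eq fun l x => by simp

/-! ### Indices for uniformly decidable families -/

theorem exists_injective_index {α : Type*} [Primcodable α] {f : α → ℕ → Bool}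
    (hf : Computable₂ f) :
    ∃ g : α → ℕ, Computable g ∧ Function.Injective g ∧ ∀ a, Wset (g a) = {x | f a x = true} := by
  let F : ℕ →. ℕ := fun q => (Encodable.decode (α := α) q.unpair.1 : Part α).bind fun a =>
    bif f a q.unpair.2 then Part.some 0 else Part.none
  have hF : Partrec F := by
    refine Partrec.bind (Computable.ofOption
      (Computable.decode.comp (Computable.fst.comp Computable.unpair))) ?_
    refine Partrec.cond (hf.comp Computable.snd
      (Computable.snd.comp (Computable.unpair.comp Computable.fst))) ?_ Partrec.none
    exact (Computable.const 0)
  obtain ⟨c, hc⟩ := Nat.Partrec.Code.exists_code.1 (Partrec.nat_iff.1 hF)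
  refine ⟨fun a => Encodable.encode (c.curry (Encodable.encode a)), ?_, ?_, ?_⟩
  · exact Computable.encode.comp
      (Nat.Partrec.Code.primrec₂_curry.to_comp.comp (Computable.const c) Computable.encode)
  · intro a b hab
    exact Encodable.encode_injective (Nat.Partrec.Code.curry_inj (Encodable.encode_injective hab)).2
  · intro a
    ext x
    have h : phi (Encodable.encode (c.curry (Encodable.encode a))) x
        = bif f a x then Part.some 0 else Part.none := by
      simp [phi, Nat.Partrec.Code.eval_curry, hc, F]
    change (phi _ x).Dom ↔ _
    rw [h]
    cases hfx : f a x <;> simp [hfx]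

/-! ### Consistent partial learners only learn decidable sets -/

/-- The family `L_{σ,y,E} = {x : M(σx) ∈ E or M(σxy) ∈ E}`, indexed by natural numbers. -/
def guessFamily (M : List (Option ℕ) → ℕ) (i x : ℕ) : Bool :=
  let q := Denumerable.ofNat (List (Option ℕ) × Option ℕ × List ℕ) i
  decide (M (q.1 ++ [some x]) ∈ q.2.2) || decide (M (q.1 ++ [some x] ++ [q.2.1]) ∈ q.2.2)

theorem computable_guessFamily {M : List (Option ℕ) → ℕ} (hM : Computable M) :
    Computable₂ (guessFamily M) := by
  have hq : Computable fun p : ℕ × ℕ =>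
      Denumerable.ofNat (List (Option ℕ) × Option ℕ × List ℕ) p.1 :=
    (Computable.ofNat _).comp Computable.fst
  have hx : Computable fun p : ℕ × ℕ =>
      (Denumerable.ofNat (List (Option ℕ) × Option ℕ × List ℕ) p.1).1 ++ [some p.2] :=
    Computable.list_concat.comp (Computable.fst.comp hq)
      (Computable.option_some.comp Computable.snd)
  have hE := (Computable.snd.comp Computable.snd).comp hq
  have hy := (Computable.fst.comp Computable.snd).comp hq
  exact Primrec.or.to_comp.comp
    (primrec_mem_list.to_comp.comp hE (hM.comp hx))
    (primrec_mem_list.to_comp.comp hE (hM.comp (Computable.list_concat.comp hx hy)))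

theorem pref_succ (T : ℕ → Option ℕ) (n : ℕ) : pref T (n + 1) = pref T n ++ [T n] := by
  simp [pref, List.range_succ]

theorem mem_pref {T : ℕ → Option ℕ} {n : ℕ} {o : Option ℕ} :
    o ∈ pref T n ↔ ∃ m < n, T m = o := by
  simp [pref]

theorem exists_guessFamily_eq {M : List (Option ℕ) → ℕ} {C : Set (Set ℕ)}
    (hcons : ConsLearner M) (hpart : PartLearns M C) {L : Set ℕ} (hL : L ∈ C) :
    ∃ i, L = {x | guessFamily M i x = true} := by
  classical
  by_contra! hne
  have hdodge : ∀ (σ : List (Option ℕ)) (k : ℕ) (y : Option ℕ), ∃ x ∈ L, ∀ e ≤ k, Wset e = L →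
      M (σ ++ [some x]) ≠ e ∧ M (σ ++ [some x] ++ [y]) ≠ e := by
    intro σ k y
    by_contra! hno
    refine hne (Encodable.encode (σ, y, (List.range (k + 1)).filter fun e => Wset e = L)) ?_
    ext x
    simp only [guessFamily, Denumerable.ofNat_encode, Set.mem_ofPred_eq, Bool.or_eq_true,
      decide_eq_true_eq, List.mem_filter, List.mem_range, Order.lt_add_one_iff]
    constructor
    · intro hx
      obtain ⟨e, hek, heL, h⟩ := hno x hx
      by_cases h1 : M (σ ++ [some x]) = e
      · exact Or.inl (h1 ▸ ⟨hek, heL⟩)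
      · exact Or.inr ((h h1) ▸ ⟨hek, heL⟩)
    · rintro (⟨-, h⟩ | ⟨-, h⟩) <;> rw [← h] <;> exact hcons _ _ (by simp)
  choose X hXL hX using hdodge
  let T₀ : ℕ → Option ℕ := fun n => if n ∈ L then some n else none
  let S : ℕ → List (Option ℕ) := fun n =>
    Nat.rec [] (fun k σ => σ ++ [some (X σ k (T₀ k))] ++ [T₀ k]) n
  let T : ℕ → Option ℕ := fun n =>
    if n % 2 = 0 then some (X (S (n / 2)) (n / 2) (T₀ (n / 2))) else T₀ (n / 2)
  have hTeven : ∀ k, T (2 * k) = some (X (S k) k (T₀ k)) := fun k => by simp [T]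
  have hTodd : ∀ k, T (2 * k + 1) = T₀ k := fun k => by
    have h1 : (2 * k + 1) % 2 = 1 := by omega
    have h2 : (2 * k + 1) / 2 = k := by omega
    simp [T, h1, h2]
  have hS : ∀ k, pref T (2 * k) = S k := by
    intro k
    induction k with
    | zero => rfl
    | succ k ih =>
      rw [show 2 * (k + 1) = 2 * k + 1 + 1 by ring, pref_succ, pref_succ, ih, hTeven, hTodd]
  have hT : IsText T L := by
    ext x
    constructor
    · rintro ⟨n, hn⟩
      rcases Nat.even_or_odd' n with ⟨k, rfl | rfl⟩
      · rw [hTeven] at hn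
        exact Option.some.inj hn ▸ hXL _ _ _
      · rw [hTodd] at hn
        by_cases hk : k ∈ L <;> simp [T₀, hk] at hn
        exact hn ▸ hk
    · intro hx
      exact ⟨2 * x + 1, by rw [hTodd]; simp [T₀, hx]⟩
  obtain ⟨e, hinf, heL, -⟩ := hpart L hL T hT
  refine hinf ((Set.finite_le_nat (2 * e)).subset fun n (hn : M (pref T n) = e) => ?_)
  by_contra hlt
  simp only [Set.mem_ofPred_eq, not_le] at hlt
  obtain ⟨k, rfl | rfl⟩ := Nat.even_or_odd' n
  · obtain ⟨j, rfl⟩ : ∃ j, k = j + 1 := ⟨k - 1, by omega⟩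
    rw [show 2 * (j + 1) = 2 * j + 1 + 1 by ring, pref_succ, pref_succ, hS, hTeven, hTodd] at hn
    exact (hX _ _ _ e (by omega) heL).2 hn
  · rw [pref_succ, hS, hTeven] at hn
    exact (hX _ _ _ e (by omega) heL).1 hn

/-! ### The learner for a uniformly decidable family together with all finite sets -/

/-- Record the datum `o` in the list `D` of the numbers seen so far. -/
def record (o : Option ℕ) (D : List ℕ) : List ℕ :=
  Option.casesOn o D fun x => bif decide (x ∈ D) then D else x :: D

/-- The numbers occurring in a sequence, without repetitions and latest first. -/
def content (σ : List (Option ℕ)) : List ℕ := σ.reverse.foldr record []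

/-- `x` is the least member of `L_i` outside `D`, and `D ⊆ L_i`. -/
def Fits (f : ℕ → ℕ → Bool) (D : List ℕ) (x i : ℕ) : Prop :=
  f i x = true ∧ (∀ z ∈ D, f i z = true) ∧ ∀ z < x, f i z = true → z ∈ D

/-- A computable test for `Fits`. -/
def fitsTest (f : ℕ → ℕ → Bool) (D : List ℕ) (x i : ℕ) : Bool :=
  f i x && ((boundedFind (fun j => !f i (D.getD j 0)) D.length).isNone &&
    (boundedFind (fun z => f i z && !decide (z ∈ D)) x).isNone)

/-- The hypothesis after seeing `o` when `D` was seen before: `inl D` stands for the finite set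
`D` and `inr i` for `L_i`. -/
def nextHyp (f : ℕ → ℕ → Bool) (D : List ℕ) (o : Option ℕ) : List ℕ ⊕ ℕ :=
  Option.casesOn o (Sum.inl D) fun x => bif decide (x ∈ D) then Sum.inl D else
    Option.casesOn (boundedFind (fitsTest f D x) (x + 1)) (Sum.inl (x :: D)) Sum.inr

/-- The hypothesis on a finite sequence. -/
def hyp (f : ℕ → ℕ → Bool) (σ : List (Option ℕ)) : List ℕ ⊕ ℕ :=
  nextHyp f (σ.reverse.tail.foldr record []) σ.reverse.headI

/-- Membership in the set described by a hypothesis. -/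
def hypMem (f : ℕ → ℕ → Bool) (h : List ℕ ⊕ ℕ) (x : ℕ) : Bool :=
  Sum.casesOn h (fun D => decide (x ∈ D)) fun i => f i x

theorem fitsTest_eq_true {f : ℕ → ℕ → Bool} {D : List ℕ} {x i : ℕ} :
    fitsTest f D x i = true ↔ Fits f D x i := by
  simp only [fitsTest, Fits, Bool.and_eq_true, Option.isNone_iff_eq_none, boundedFind_eq_none,
    Bool.not_eq_false', Bool.and_eq_false_imp, decide_eq_true_eq]
  refine and_congr_right fun _ => and_congr_left fun _ => ?_
  constructor
  · intro h z hz
    obtain ⟨j, hj, rfl⟩ := List.mem_iff_getElem.1 hz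
    exact List.getD_eq_getElem D 0 hj ▸ h j hj
  · intro h j hj
    rw [List.getD_eq_getElem _ _ hj]
    exact h _ (List.getElem_mem hj)

theorem computable_hypMem {f : ℕ → ℕ → Bool} (hf : Computable₂ f) : Computable₂ (hypMem f) :=
  Computable.sumCasesOn Computable.fst
    (primrec_mem_list.to_comp.comp Computable.snd (Computable.snd.comp Computable.fst)).to₂
    (hf.comp Computable.snd (Computable.snd.comp Computable.fst)).to₂

theorem primrec_record : Primrec₂ record := by
  refine Primrec.option_casesOn Primrec.fst Primrec.snd ?_
  have hx : Primrec fun p : (Option ℕ × List ℕ) × ℕ => p.2 := Primrec.snd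
  have hD : Primrec fun p : (Option ℕ × List ℕ) × ℕ => p.1.2 := Primrec.snd.comp Primrec.fst
  exact Primrec.cond (primrec_mem_list.comp hD hx) hD (Primrec.list_cons.comp hx hD)

theorem computable_fitsTest {f : ℕ → ℕ → Bool} (hf : Computable₂ f) :
    Computable₂ fun (p : List ℕ × ℕ) i => fitsTest f p.1 p.2 i := by
  have hD : Computable fun q : (List ℕ × ℕ) × ℕ => q.1.1 := Computable.fst.comp Computable.fst
  have hx : Computable fun q : (List ℕ × ℕ) × ℕ => q.1.2 := Computable.snd.comp Computable.fst
  have hi : Computable fun q : (List ℕ × ℕ) × ℕ => q.2 := Computable.snd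
  have hnone : Computable (Option.isNone : Option ℕ → Bool) :=
    (Primrec.not.comp Primrec.option_isSome).to_comp.of_eq fun o => by cases o <;> rfl
  refine Primrec.and.to_comp.comp (hf.comp hi hx) (Primrec.and.to_comp.comp
    (hnone.comp (computable_boundedFind ?_ (Computable.list_length.comp hD)))
    (hnone.comp (computable_boundedFind ?_ hx)))
  · exact Primrec.not.to_comp.comp (hf.comp (hi.comp Computable.fst)
      ((Primrec.list_getD 0).to_comp.comp (hD.comp Computable.fst) Computable.snd))
  · exact Primrec.and.to_comp.comp (hf.comp (hi.comp Computable.fst) Computable.snd)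
      (Primrec.not.to_comp.comp
        (primrec_mem_list.to_comp.comp (hD.comp Computable.fst) Computable.snd))

theorem computable_nextHyp {f : ℕ → ℕ → Bool} (hf : Computable₂ f) : Computable₂ (nextHyp f) := by
  have hD : Computable fun q : (List ℕ × Option ℕ) × ℕ => q.1.1 :=
    Computable.fst.comp Computable.fst
  have hx : Computable fun q : (List ℕ × Option ℕ) × ℕ => q.2 := Computable.snd
  have htest : Computable₂ fun (q : (List ℕ × Option ℕ) × ℕ) i => fitsTest f q.1.1 q.2 i :=
    Computable₂.comp₂ (f := fun (p : List ℕ × ℕ) i => fitsTest f p.1 p.2 i)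
      (g := fun (q : (List ℕ × Option ℕ) × ℕ) (_ : ℕ) => (q.1.1, q.2)) (h := fun _ i => i)
      (computable_fitsTest hf) ((hD.pair hx).comp Computable.fst).to₂ Computable.snd.to₂
  have hfind : Computable fun q : (List ℕ × Option ℕ) × ℕ =>
      boundedFind (fitsTest f q.1.1 q.2) (q.2 + 1) :=
    computable_boundedFind htest (Computable.succ.comp hx)
  have hnew : Computable fun q : (List ℕ × Option ℕ) × ℕ =>
      (Option.casesOn (boundedFind (fitsTest f q.1.1 q.2) (q.2 + 1)) (Sum.inl (q.2 :: q.1.1))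
        Sum.inr : List ℕ ⊕ ℕ) :=
    Computable.option_casesOn hfind (Computable.sumInl.comp (Computable.list_cons.comp hx hD))
      (Computable.sumInr.comp Computable.snd).to₂
  have hsome : Computable₂ fun (q : List ℕ × Option ℕ) (x : ℕ) =>
      bif decide (x ∈ q.1) then (Sum.inl q.1 : List ℕ ⊕ ℕ) else
        Option.casesOn (boundedFind (fitsTest f q.1 x) (x + 1)) (Sum.inl (x :: q.1)) Sum.inr :=
    Computable.cond (primrec_mem_list.to_comp.comp hD hx) (Computable.sumInl.comp hD) hnew
  exact Computable.option_casesOn Computable.snd (Computable.sumInl.comp Computable.fst) hsome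

theorem computable_hyp {f : ℕ → ℕ → Bool} (hf : Computable₂ f) : Computable (hyp f) := by
  have hc : Primrec fun σ : List (Option ℕ) => σ.reverse.tail.foldr record [] :=
    Primrec.list_foldr (h := fun _ p => record p.1 p.2)
      (Primrec.list_tail.comp Primrec.list_reverse) (Primrec.const [])
      (primrec_record.comp (Primrec.fst.comp Primrec.snd) (Primrec.snd.comp Primrec.snd)).to₂
  exact (computable_nextHyp hf).comp hc.to_comp
    (Primrec.list_headI.comp Primrec.list_reverse).to_comp

theorem mem_record {o : Option ℕ} {D : List ℕ} {x : ℕ} :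
    x ∈ record o D ↔ o = some x ∨ x ∈ D := by
  cases o with
  | none => simp [record]
  | some y =>
    by_cases hy : y ∈ D
    · simp only [record, hy, decide_true, cond_true, Option.some.injEq]
      exact ⟨Or.inr, fun h => h.elim (fun h => h ▸ hy) id⟩
    · simp [record, hy, eq_comm]

theorem content_concat (σ : List (Option ℕ)) (o : Option ℕ) :
    content (σ ++ [o]) = record o (content σ) := by
  simp [content]

theorem hyp_concat (f : ℕ → ℕ → Bool) (σ : List (Option ℕ)) (o : Option ℕ) :
    hyp f (σ ++ [o]) = nextHyp f (content σ) o := by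
  simp [hyp, content]

theorem mem_content {σ : List (Option ℕ)} {x : ℕ} : x ∈ content σ ↔ some x ∈ σ := by
  induction σ using List.reverseRecOn with
  | nil => simp [content]
  | append_singleton σ o ih =>
    rw [content_concat, mem_record, ih]
    simp [or_comm, eq_comm]

/-- Either the finite set seen so far is conjectured, or a new number `x` has arrived and the
conjecture is the first fitting member of the family. -/
theorem nextHyp_cases (f : ℕ → ℕ → Bool) (D : List ℕ) (o : Option ℕ) :
    nextHyp f D o = Sum.inl (record o D) ∨
      ∃ x i, o = some x ∧ x ∉ D ∧ nextHyp f D o = Sum.inr i ∧ i ≤ x ∧ Fits f D x i ∧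
        ∀ j < i, ¬ Fits f D x j := by
  cases o with
  | none => exact Or.inl rfl
  | some x =>
    by_cases hx : x ∈ D
    · left; simp [nextHyp, record, hx]
    · cases hb : boundedFind (fitsTest f D x) (x + 1) with
      | none => left; simp [nextHyp, record, hx, hb]
      | some i =>
        obtain ⟨h1, h2, h3⟩ := boundedFind_eq_some hb
        refine Or.inr ⟨x, i, rfl, hx, by simp [nextHyp, hx, hb], by omega,
          fitsTest_eq_true.1 h2, fun j hj hfit => ?_⟩
        exact absurd (fitsTest_eq_true.2 hfit) (by simp [h3 j hj])

theorem nextHyp_of_fits {f : ℕ → ℕ → Bool} {D : List ℕ} {x i : ℕ} (hx : x ∉ D) (hi : i ≤ x)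
    (hfit : Fits f D x i) : ∃ j ≤ i, nextHyp f D (some x) = Sum.inr j := by
  cases hb : boundedFind (fitsTest f D x) (x + 1) with
  | none =>
    have := boundedFind_eq_none.1 hb i (by omega)
    simp [fitsTest_eq_true.2 hfit] at this
  | some j =>
    refine ⟨j, ?_, by simp [nextHyp, hx, hb]⟩
    by_contra! hlt
    have := (boundedFind_eq_some hb).2.2 i hlt
    simp [fitsTest_eq_true.2 hfit] at this

theorem hypMem_hyp {f : ℕ → ℕ → Bool} {σ : List (Option ℕ)} {x : ℕ} (hx : some x ∈ σ) :
    hypMem f (hyp f σ) x = true := by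
  induction σ using List.reverseRecOn with
  | nil => simp at hx
  | append_singleton σ o _ =>
    rw [← mem_content, content_concat] at hx
    rw [hyp_concat]
    rcases nextHyp_cases f (content σ) o with h | ⟨y, i, rfl, -, h, -, hfit, -⟩
    · simp [h, hypMem, hx]
    · rw [h]
      rcases mem_record.1 hx with hy | hx
      · exact Option.some.inj hy ▸ hfit.1
      · exact hfit.2.1 x hx

/-! ### Behaviour on texts -/

section Text

variable {f : ℕ → ℕ → Bool} {L : Set ℕ} {T : ℕ → Option ℕ}

theorem IsText.mem (hT : IsText T L) {n x : ℕ} (h : T n = some x) : x ∈ L :=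
  hT ▸ (⟨n, h⟩ : ∃ n, T n = some x)

theorem IsText.mem_of_content (hT : IsText T L) {n x : ℕ} (h : x ∈ content (pref T n)) :
    x ∈ L := by
  obtain ⟨m, -, hm⟩ := mem_pref.1 (mem_content.1 h)
  exact IsText.mem hT hm

theorem IsText.eventually_mem_content (hT : IsText T L) {x : ℕ} (hx : x ∈ L) :
    ∀ᶠ n in atTop, x ∈ content (pref T n) := by
  rw [← hT] at hx
  obtain ⟨m, hm⟩ := hx
  filter_upwards [eventually_gt_atTop m] with n hn
  exact mem_content.2 (mem_pref.2 ⟨m, hn, hm⟩)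

theorem IsText.eventually_forall_mem_content (hT : IsText T L) {A : Set ℕ} (hA : A.Finite) :
    ∀ᶠ n in atTop, ∀ x ∈ A, x ∈ L → x ∈ content (pref T n) := by
  rw [eventually_all_finite hA]
  intro x _
  by_cases hx : x ∈ L
  · filter_upwards [IsText.eventually_mem_content hT hx] with n hn _ using hn
  · exact Eventually.of_forall fun n h => absurd h hx

theorem eventually_hypMem_iff (hT : IsText T L) (b : ℕ) :
    ∀ᶠ n in atTop, ∀ z < b, hypMem f (hyp f (pref T n)) z = true ↔ z ∈ L := by
  rw [← map_add_atTop_eq_nat 1, eventually_map]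
  filter_upwards [IsText.eventually_forall_mem_content hT (Set.finite_lt_nat b)] with n hn z hz
  refine ⟨fun h => ?_, fun h => hypMem_hyp ?_⟩
  · rw [pref_succ, hyp_concat] at h
    rcases nextHyp_cases f (content (pref T n)) (T n) with h' | ⟨x, i, hx, hxD, h', -, hfit, -⟩
    · simp only [h', hypMem, decide_eq_true_eq] at h
      rcases mem_record.1 h with h | h
      · exact IsText.mem hT h
      · exact IsText.mem_of_content hT h
    · rw [h'] at h
      have hbx : b ≤ x := by
        by_contra! hlt
        exact hxD (hn x hlt (IsText.mem hT hx))
      exact IsText.mem_of_content hT (hfit.2.2 z (hz.trans_le hbx) h)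
  · rw [pref_succ]
    exact List.mem_append_left _ (mem_content.1 (hn z hz h))

theorem setOf_hypMem_eq_of_infinite (hT : IsText T L) {h : List ℕ ⊕ ℕ}
    (hinf : {n | hyp f (pref T n) = h}.Infinite) : {x | hypMem f h x = true} = L := by
  ext x
  obtain ⟨n, hn, hx⟩ := ((Nat.frequently_atTop_iff_infinite.2 hinf).and_eventually
    (eventually_hypMem_iff (f := f) hT (x + 1))).exists
  have := hx x (Nat.lt_succ_self x)
  rwa [hn] at this

theorem exists_eventually_hyp_eq (hT : IsText T L) (hL : L.Finite) :
    ∃ h, ∀ᶠ n in atTop, hyp f (pref T n) = h := by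
  obtain ⟨m, hm⟩ := eventually_atTop.1 (IsText.eventually_forall_mem_content hT hL)
  have hrec : ∀ n ≥ m, record (T n) (content (pref T n)) = content (pref T n) := by
    intro n hn
    cases ho : T n with
    | none => rfl
    | some x =>
      have hx := IsText.mem hT ho
      simp [record, hm n hn x hx hx]
  have hconst : ∀ n ≥ m, content (pref T n) = content (pref T m) := by
    intro n hn
    induction n, hn using Nat.le_induction with
    | base => rfl
    | succ n hn ih => rw [pref_succ, content_concat, hrec n hn, ih]
  refine ⟨Sum.inl (content (pref T m)), ?_⟩
  rw [← map_add_atTop_eq_nat 1, eventually_map]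
  filter_upwards [eventually_ge_atTop m] with n hn
  rw [pref_succ, hyp_concat]
  rcases nextHyp_cases f (content (pref T n)) (T n) with h | ⟨x, i, hx, hxD, -⟩
  · rw [h, hrec n hn, hconst n hn]
  · have hxL := IsText.mem hT hx
    exact absurd (hm n hn x hxL hxL) hxD

/-- The first time at which the least missing element of `L` appears, `L` itself fits. -/
theorem frequently_hyp_eq_inr (hT : IsText T L) (hL : L.Infinite) {i : ℕ}
    (hi : L = {x | f i x = true}) :
    ∃ᶠ n in atTop, ∃ j ≤ i, hyp f (pref T n) = Sum.inr j := by
  classical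
  rw [frequently_atTop]
  intro m
  obtain ⟨n, hmn, hn⟩ := ((eventually_ge_atTop m).and
    (IsText.eventually_forall_mem_content hT (Set.finite_lt_nat i))).exists
  have hex : ∃ x, x ∈ L ∧ x ∉ content (pref T n) := by
    obtain ⟨x, hx, hxn⟩ := hL.exists_notMem_finset (content (pref T n)).toFinset
    exact ⟨x, hx, by simpa using hxn⟩
  obtain ⟨hxL, hxn⟩ := Nat.find_spec hex
  set x := Nat.find hex
  have hmin : ∀ z < x, z ∈ L → z ∈ content (pref T n) := fun z hz hzL => by
    by_contra h
    exact Nat.find_min hex hz ⟨hzL, h⟩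
  have hTx : ∃ k, T k = some x := by rw [← hT] at hxL; exact hxL
  set k := Nat.find hTx
  have hk : T k = some x := Nat.find_spec hTx
  have hnk : n ≤ k := by
    by_contra! hlt
    exact hxn (mem_content.2 (mem_pref.2 ⟨k, hlt, hk⟩))
  have hxk : x ∉ content (pref T k) := fun h => by
    obtain ⟨l, hl, hTl⟩ := mem_pref.1 (mem_content.1 h)
    exact Nat.find_min hTx hl hTl
  have hix : i ≤ x := by
    by_contra! hlt
    exact hxn (hn x hlt hxL)
  have hfit : Fits f (content (pref T k)) x i := by
    refine ⟨by rwa [hi] at hxL, fun z hz => ?_, fun z hz hzi => ?_⟩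
    · have := IsText.mem_of_content hT hz
      rwa [hi] at this
    · obtain ⟨l, hl, hTl⟩ := mem_pref.1 (mem_content.1 (hmin z hz (by rw [hi]; exact hzi)))
      exact mem_content.2 (mem_pref.2 ⟨l, hl.trans_le hnk, hTl⟩)
  obtain ⟨j, hj, h⟩ := nextHyp_of_fits hxk hix hfit
  exact ⟨k + 1, by omega, j, hj, by rw [pref_succ, hyp_concat, hk, h]⟩

theorem hyp_eq_inr_min {i j n : ℕ} (hij : ∀ x, f i x = f j x)
    (hj : hyp f (pref T n) = Sum.inr j) : j ≤ i := by
  cases n with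
  | zero => simp [pref, hyp, nextHyp] at hj
  | succ n =>
    rw [pref_succ, hyp_concat] at hj
    rcases nextHyp_cases f (content (pref T n)) (T n) with h | ⟨x, k, -, -, h, -, hfit, hmin⟩
    · simp [h] at hj
    · obtain rfl : k = j := by simpa [h] using hj
      by_contra! hlt
      exact hmin i hlt (by simpa only [Fits, hij] using hfit)

theorem existsUnique_infinite_hyp (hT : IsText T L)
    (hL : L.Finite ∨ ∃ i, L = {x | f i x = true}) :
    ∃! h, {n | hyp f (pref T n) = h}.Infinite := by
  classical
  by_cases hfin : L.Finite
  · obtain ⟨h, hh⟩ := exists_eventually_hyp_eq (f := f) hT hfin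
    refine ⟨h, Nat.frequently_atTop_iff_infinite.1 hh.frequently, fun h' hinf => ?_⟩
    obtain ⟨n, h1, h2⟩ :=
      ((Nat.frequently_atTop_iff_infinite.2 hinf).and_eventually hh).exists
    exact h1.symm.trans h2
  · have hex := hL.resolve_left hfin
    have hi := Nat.find_spec hex
    set i := Nat.find hex
    have huniq : ∀ h, {n | hyp f (pref T n) = h}.Infinite → h = Sum.inr i := by
      intro h hinf
      have hset := setOf_hypMem_eq_of_infinite hT hinf
      cases h with
      | inl D =>
        refine absurd ?_ hfin
        rw [← hset]
        exact (List.finite_toSet D).subset fun x hx => by simpa [hypMem] using hx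
      | inr j =>
        obtain ⟨n, hn⟩ := hinf.nonempty
        have hle : j ≤ i := hyp_eq_inr_min (fun x => by
          have : x ∈ {x | f i x = true} ↔ x ∈ {x | f j x = true} := by
            rw [← hi, ← hset]; rfl
          exact Bool.eq_iff_iff.2 this) hn
        exact congrArg _ (le_antisymm hle (Nat.find_min' hex hset.symm))
    have hfreq := frequently_hyp_eq_inr hT hfin hi
    obtain ⟨j, -, hj⟩ : ∃ j ∈ Set.Iic i, {n | hyp f (pref T n) = Sum.inr j}.Infinite := by
      by_contra! hno
      refine Nat.frequently_atTop_iff_infinite.1 hfreq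
        (((Set.finite_Iic i).biUnion hno).subset ?_)
      rintro n ⟨j, hj, hn⟩
      exact Set.mem_biUnion hj hn
    exact ⟨Sum.inr i, huniq _ hj ▸ hj, huniq⟩

end Text

/-- A uniformly decidable family together with all finite sets is learnable by a consistent,
partial, finitely approximating learner conjecturing only sets from this class. -/
theorem exists_learner_of_computable {f : ℕ → ℕ → Bool} (hf : Computable₂ f) :
    ∃ N : List (Option ℕ) → ℕ, Computable N ∧ ConsLearner N ∧
      (∀ S ∈ Conjectured N, S.Finite ∨ ∃ i, S = {x | f i x = true}) ∧
      PartLearns N {S | S.Finite ∨ ∃ i, S = {x | f i x = true}} ∧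
      FinApproxLearns N {S | S.Finite ∨ ∃ i, S = {x | f i x = true}} := by
  obtain ⟨g, hg, hinj, hW⟩ := exists_injective_index (computable_hypMem hf)
  refine ⟨fun σ => g (hyp f σ), hg.comp (computable_hyp hf), ?_, ?_, ?_, ?_⟩
  · intro σ x hx
    rw [hW]
    exact hypMem_hyp hx
  · rintro S ⟨σ, rfl⟩
    rw [hW]
    cases hyp f σ with
    | inl D => exact Or.inl ((List.finite_toSet D).subset fun x hx => by simpa [hypMem] using hx)
    | inr i => exact Or.inr ⟨i, rfl⟩
  · intro L hL T hT
    obtain ⟨h, hinf, huniq⟩ := existsUnique_infinite_hyp hT hL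
    have hset : ∀ h', {n | g (hyp f (pref T n)) = g h'} = {n | hyp f (pref T n) = h'} :=
      fun h' => Set.ext fun n => hinj.eq_iff
    refine ⟨g h, by rwa [hset], (hW h).trans (setOf_hypMem_eq_of_infinite hT hinf), ?_⟩
    intro d hd
    obtain ⟨n, rfl⟩ := hd.nonempty
    rw [hset] at hd
    exact congrArg g (huniq _ hd)
  · intro L _ T hT D
    obtain ⟨b, hb⟩ := D.bddAbove
    filter_upwards [eventually_hypMem_iff (f := f) hT (b + 1)] with n hn
    ext x
    rw [hW]
    exact and_congr_left fun hx => hn x (Nat.lt_succ_of_le (hb hx))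

end PartialLearning

/-- If `C` is ConsPart learnable then `C` is FinApproxConsPart learnable by a
prudent learner (prudence: the learner learns, with respect to the same
criteria, every set it ever conjectures). -/
theorem stmt9 (C : Set (Set ℕ)) (hC : ∀ L ∈ C, ∃ e, Wset e = L)
    (h : ∃ M : List (Option ℕ) → ℕ, Computable M ∧ ConsLearner M ∧ PartLearns M C) :
    ∃ N : List (Option ℕ) → ℕ, Computable N ∧ ConsLearner N ∧
      PartLearns N (C ∪ Conjectured N) ∧
      FinApproxLearns N (C ∪ Conjectured N) := by
  obtain ⟨M, hM, hcons, hpart⟩ := h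
  obtain ⟨N, hN, hNcons, hconj, hNpart, hNfin⟩ :=
    PartialLearning.exists_learner_of_computable (PartialLearning.computable_guessFamily hM)
  have hsub : ∀ L ∈ C ∪ Conjectured N,
      L ∈ {S : Set ℕ | S.Finite ∨ ∃ i, S = {x | PartialLearning.guessFamily M i x = true}} := by
    rintro L (hL | hL)
    · exact Or.inr (PartialLearning.exists_guessFamily_eq hcons hpart hL)
    · exact hconj L hL
  exact ⟨N, hN, hNcons, fun L hL => hNpart L (hsub L hL), fun L hL => hNfin L (hsub L hL)⟩
end
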